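/- Let G be any non-abelian finite simple group not isomorphic to A_5. Then ed_ℂ(G; ≤ 2) > 1. -/

import Mathlib

open IntermediateField Multiplicative

/-- `K` is (the function field of) an irreducible variety over `k`:
a finitely generated field extension of `k`. -/
def IsFunctionField (k K : Type) [Field k] [Field K] [Algebra k K] : Prop :=
  ∃ s : Finset K, IntermediateField.adjoin k (s : Set K) = ⊤

/-- The variety with function field `K` has dimension at most `d`, i.e. the
transcendence degree of `K/k` is at most `d`. -/
def DimLE (k K : Type) [Field k] [Field K] [Algebra k K] (d : ℕ) : Prop :=
  ∃ s : Finset K, s.card ≤ d ∧ Algebra.IsAlgebraic (IntermediateField.adjoin k (s : Set K)) K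

/-- `K` is the function field of an irreducible algebraic curve over `k`: a finitely
generated field extension of `k` of transcendence degree one. -/
def IsCurveField (k K : Type) [Field k] [Field K] [Algebra k K] : Prop :=
  IsFunctionField k K ∧ DimLE k K 1 ∧ ∃ x : K, Transcendental k x

/-- The rational function `f` on the curve with function field `K` has degree `n`,
i.e. the corresponding dominant rational map to `P¹` is generically `n`-to-1:
`[K : k(f)] = n` (in particular this extension is finite). -/
def RatFnDegree (k K : Type) [Field k] [Field K] [Algebra k K] (f : K) (n : ℕ) : Prop :=
  FiniteDimensional (IntermediateField.adjoin k ({f} : Set K)) K ∧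
    Module.finrank (IntermediateField.adjoin k ({f} : Set K)) K = n

/-- A faithful `G`-variety over `k`, in birational terms: a finitely generated
field extension `K/k` (the function field) equipped with a faithful `G`-action
on `K` by `k`-automorphisms (i.e. a faithful action on the variety by birational
automorphisms). -/
structure GVariety (k : Type) [Field k] (G : Type) [Group G] where
  K : Type
  [field : Field K]
  [algebra : Algebra k K]
  fg : IsFunctionField k K
  action : G →* (K ≃ₐ[k] K)
  faithful : Function.Injective action

attribute [instance] GVariety.field GVariety.algebra

section ED

variable {k : Type} [Field k] {G : Type} [Group G]

/-- A `G`-compression `X ⇢ Y`: a dominant rational `G`-map, i.e. a `G`-equivariant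
`k`-embedding of function fields `k(Y) ↪ k(X)`. -/
def GVariety.Compression (X Y : GVariety k G) : Prop :=
  ∃ φ : Y.K →ₐ[k] X.K, ∀ (g : G) (y : Y.K), X.action g (φ y) = φ (Y.action g y)

/-- `T ⇢ X` is a `G`-equivariant branched cover of degree at most `n`: a
`G`-equivariant `k`-embedding of function fields `k(X) ↪ k(T)` with
`[k(T) : k(X)] ≤ n`. -/
def GVariety.IsCoverDegLE (T X : GVariety k G) (n : ℕ) : Prop :=
  ∃ ι : X.K →ₐ[k] T.K,
    FiniteDimensional ι.fieldRange T.K ∧ Module.finrank ι.fieldRange T.K ≤ n ∧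
    ∀ (g : G) (x : X.K), T.action g (ι x) = ι (X.action g x)

end ED

/-- `ed_k(G; ≤ n) ≤ d`: every faithful `G`-variety `X` over `k` admits a
`G`-equivariant branched cover `X̃ ⇢ X` of degree at most `n` together with a
`G`-compression `X̃ ⇢ Y` to a faithful `G`-variety `Y` of dimension at most `d`.
Thus `ed_k(G; ≤ n) > d` is the negation `¬ EDLE k G n d`. -/
def EDLE (k : Type) [Field k] (G : Type) [Group G] (n d : ℕ) : Prop :=
  ∀ X : GVariety k G, ∃ T Y : GVariety k G,
    T.IsCoverDegLE X n ∧ T.Compression Y ∧ DimLE k Y.K d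

theorem card_dvd_factorial_index_of_isSimpleGroup {G : Type*} [Group G] [Finite G]
    [IsSimpleGroup G] (H : Subgroup G) (hH : H ≠ ⊤) : Nat.card G ∣ (H.index).factorial := by
  classical
  have hk : (MulAction.toPermHom G (G ⧸ H)).ker = ⊥ := by
    refine ((MulAction.toPermHom G (G ⧸ H)).normal_ker.eq_bot_or_eq_top).resolve_right
      fun h => hH ?_
    rw [← Subgroup.normalCore_eq_ker] at h
    exact top_le_iff.mp (h ▸ H.normalCore_le)
  have hi := (MonoidHom.ker_eq_bot_iff _).mp hk
  have := Subgroup.card_dvd_of_injective _ hi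
  rwa [Nat.card_perm, ← Subgroup.index_eq_card] at this

theorem nonempty_mulEquiv_alternatingGroup_of_index_eq_five {G : Type*} [Group G] [Finite G]
    [IsSimpleGroup G] (hc : Nat.card G = 60) (H : Subgroup G) (hH : H.index = 5) :
    Nonempty (G ≃* alternatingGroup (Fin 5)) := by
  classical
  have hk : (MulAction.toPermHom G (G ⧸ H)).ker = ⊥ := by
    refine ((MulAction.toPermHom G (G ⧸ H)).normal_ker.eq_bot_or_eq_top).resolve_right fun h => ?_
    rw [← Subgroup.normalCore_eq_ker] at h
    have := top_le_iff.mp (h ▸ H.normalCore_le)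
    simp [this] at hH
  have hi := (MonoidHom.ker_eq_bot_iff _).mp hk
  have hq : Nat.card (G ⧸ H) = Nat.card (Fin 5) := by
    rw [← Subgroup.index_eq_card, hH]; simp
  let e : G ⧸ H ≃ Fin 5 := (Finite.equivFinOfCardEq (hq.trans (by simp)))
  let f : G →* Equiv.Perm (Fin 5) :=
    (e.permCongrHom : Equiv.Perm (G ⧸ H) ≃* Equiv.Perm (Fin 5)).toMonoidHom.comp
      (MulAction.toPermHom G (G ⧸ H))
  have hf : Function.Injective f := e.permCongrHom.injective.comp hi
  have hr : Nat.card f.range = 60 := by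
    rw [← hc]; exact (Nat.card_congr (MonoidHom.ofInjective hf).toEquiv).symm
  have hidx : f.range.index = 2 := by
    have := f.range.card_mul_index
    rw [hr, Nat.card_perm] at this
    simp [Nat.factorial] at this
    omega
  have := Equiv.Perm.eq_alternatingGroup_of_index_eq_two hidx
  exact ⟨(MonoidHom.ofInjective hf).trans (MulEquiv.subgroupCongr this)⟩

theorem index_ne_two_of_isSimpleGroup {G : Type*} [Group G] [Finite G] [IsSimpleGroup G]
    (hna : ∃ a b : G, a * b ≠ b * a) (H : Subgroup G) : ¬ (H.index ≤ 2 ∧ H ≠ ⊤) := by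
  rintro ⟨hi, hH⟩
  have h := card_dvd_factorial_index_of_isSimpleGroup H hH
  have h2 : Nat.card G ∣ 2 := h.trans (by simpa using Nat.factorial_dvd_factorial hi)
  obtain ⟨a, b, hab⟩ := hna
  rcases (Nat.dvd_prime Nat.prime_two).mp h2 with h1 | h1
  · have := (Nat.card_eq_one_iff_unique.mp h1).1
    exact hab (Subsingleton.elim _ _)
  · have := isCyclic_of_prime_card (p := 2) h1
    have := IsCyclic.isMulCommutative (α := G)
    exact hab (this.is_comm.comm a b)

theorem card_sylow_eq_sq_of_card_eq {G : Type*} [Group G] [Finite G] {p : ℕ} [Fact p.Prime]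
    (P : Sylow p G) {n : ℕ} (hn : Nat.card G = p ^ 2 * n) (hpn : ¬ p ∣ n) :
    Nat.card P = p ^ 2 := by
  rw [P.card_eq_multiplicity, hn]
  have hp : p.Prime := Fact.out
  have hn0 : n ≠ 0 := by rintro rfl; simp at hpn
  rw [Nat.factorization_mul (pow_ne_zero _ hp.ne_zero) hn0]
  simp [hp.factorization, Nat.factorization_eq_zero_of_not_dvd hpn]

theorem nonempty_mulEquiv_alternatingGroup_of_card_eq_sixty {G : Type*} [Group G] [Finite G]
    [IsSimpleGroup G] (hc : Nat.card G = 60) :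
    Nonempty (G ≃* alternatingGroup (Fin 5)) := by
  classical
  have : Fact (Nat.Prime 2) := ⟨Nat.prime_two⟩
  obtain ⟨P⟩ : Nonempty (Sylow 2 G) := inferInstance
  have hP : Nat.card P = 2 ^ 2 := card_sylow_eq_sq_of_card_eq P (n := 15) (by simpa using hc)
    (by norm_num)
  have hPi : (P : Subgroup G).index = 15 := by
    have := (P : Subgroup G).card_mul_index
    rw [hc, show Nat.card (P : Subgroup G) = 4 by simpa using hP] at this
    omega
  have hd := P.card_dvd_index
  rw [hPi, P.card_eq_index_normalizer] at hd
  set N := Subgroup.normalizer (P : Set G) with hN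
  have hPtop : (P : Subgroup G) ≠ ⊤ := by
    intro h; rw [h] at hPi; simp at hPi
  have hPbot : (P : Subgroup G) ≠ ⊥ := by
    intro h; rw [h, Subgroup.index_bot] at hPi; omega
  have hNtop : N ≠ ⊤ := by
    intro h
    have : (P : Subgroup G).Normal := Subgroup.normalizer_eq_top_iff.mp h
    exact this.eq_bot_or_eq_top.elim hPbot hPtop
  have hN1 : N.index ≠ 1 := by rwa [Ne, Subgroup.index_eq_one]
  have hle : N.index ≤ 15 := Nat.le_of_dvd (by norm_num) hd
  have hcases : N.index = 3 ∨ N.index = 5 ∨ N.index = 15 := by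
    interval_cases N.index <;> simp_all
  rcases hcases with h | h | h
  · have := card_dvd_factorial_index_of_isSimpleGroup N hNtop
    rw [h, hc] at this
    norm_num [Nat.factorial] at this
  · exact nonempty_mulEquiv_alternatingGroup_of_index_eq_five hc N h
  · exfalso
    have hPN : N = P := by
      have hle : (P : Subgroup G) ≤ N := Subgroup.le_normalizer
      refine (Subgroup.eq_of_le_of_card_ge hle ?_).symm
      have := N.card_mul_index
      rw [h, hc] at this
      have h4 : Nat.card (P : Subgroup G) = 4 := by simpa using hP
      omega
    have hcomm : IsMulCommutative P := IsPGroup.isMulCommutative_of_card_eq_prime_sq hP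
    have hNC : N ≤ Subgroup.centralizer (P : Set G) := by
      rw [hPN]
      intro x hx y hy
      exact congrArg Subtype.val (hcomm.is_comm.comm ⟨y, hy⟩ ⟨x, hx⟩)
    have hcompl := MonoidHom.ker_transferSylow_isComplement' P hNC
    have hidx := hcompl.index_eq_card
    have hnorm := (MonoidHom.transferSylow P hNC).normal_ker
    rw [hPi] at hidx
    rcases hnorm.eq_bot_or_eq_top with hb | hb
    · rw [hb] at hidx; simp at hidx
    · rw [hb, Subgroup.card_top, hc] at hidx
      omega

theorem not_isSimpleGroup_of_card_eq_two_pow_mul_three {G : Type*} [Group G] [Finite G]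
    [IsSimpleGroup G] {k : ℕ} (hk : 2 ≤ k) (hc : Nat.card G = 2 ^ k * 3) : False := by
  classical
  have : Fact (Nat.Prime 2) := ⟨Nat.prime_two⟩
  obtain ⟨P⟩ : Nonempty (Sylow 2 G) := inferInstance
  have hP : Nat.card (P : Subgroup G) = 2 ^ k := by
    have := P.card_eq_multiplicity
    rw [hc, Nat.factorization_mul (by positivity) (by norm_num)] at this
    simpa [Nat.prime_two.factorization,
      Nat.factorization_eq_zero_of_not_dvd (show ¬ 2 ∣ 3 by norm_num)] using this
  have h4 : 2 ^ 2 ≤ 2 ^ k := Nat.pow_le_pow_right (by norm_num) hk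
  have hPi : (P : Subgroup G).index = 3 := by
    have := (P : Subgroup G).card_mul_index
    rw [hc, hP] at this
    exact Nat.eq_of_mul_eq_mul_left (by positivity) this
  have hPtop : (P : Subgroup G) ≠ ⊤ := by
    intro h; rw [h] at hPi; simp at hPi
  have := card_dvd_factorial_index_of_isSimpleGroup _ hPtop
  rw [hPi, hc] at this
  have := Nat.le_of_dvd (by norm_num) this
  norm_num [Nat.factorial] at this
  omega

theorem orbit_sizes_arith {n a b c x y z : ℕ} (ha : a * x = n) (hb : b * y = n)
    (hc : c * z = n) (hc3 : 3 ≤ c) (hx : 2 ≤ x) (hxy : x ≤ y)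
    (hyz : y ≤ z) (h : a + b + c = n + 2) : n = 12 ∨ n = 24 ∨ n = 60 := by
  have hx2 : x = 2 := by
    by_contra hne
    have : 3 ≤ x := by omega
    nlinarith
  subst hx2
  have hy3 : y = 2 ∨ y = 3 := by
    by_contra! hne
    have : 4 ≤ y := by omega
    nlinarith
  rcases hy3 with rfl | rfl
  · omega
  · have hz : z ≤ 5 := by
      by_contra! hne
      have : 6 ≤ z := by omega
      nlinarith
    interval_cases z <;> omega

theorem card_eq_sixty_of_two_fixed_points {G X : Type*} [Group G] [Finite G] [IsSimpleGroup G]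
    (hna : ∃ a b : G, a * b ≠ b * a) [MulAction G X] [Finite X]
    (h2 : ∀ g : G, g ≠ 1 → Nat.card (MulAction.fixedBy X g) = 2)
    (hbot : ∀ x : X, MulAction.stabilizer G x ≠ ⊥)
    (htop : ∀ x : X, MulAction.stabilizer G x ≠ ⊤) : Nat.card G = 60 := by
  classical
  have := Fintype.ofFinite G
  have := Fintype.ofFinite X
  let Ω := Quotient (MulAction.orbitRel G X)
  have : Fintype Ω := Fintype.ofFinite _
  set n := Nat.card G with hn
  have hn2 : 2 ≤ n := Finite.one_lt_card
  have hburn := MulAction.sum_card_fixedBy_eq_card_orbits_mul_card_group G X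
  rw [← Finset.add_sum_erase _ _ (Finset.mem_univ (1 : G)),
    Finset.sum_congr rfl (fun g hg => show _ = 2 by
      rw [← Nat.card_eq_fintype_card]; exact h2 g (Finset.ne_of_mem_erase hg)),
    Finset.sum_const, Finset.card_erase_of_mem (Finset.mem_univ _), Finset.card_univ,
    smul_eq_mul, ← Nat.card_eq_fintype_card (α := G), ← hn] at hburn
  have h1 : Fintype.card (MulAction.fixedBy X (1 : G)) = Fintype.card X := by
    refine Fintype.card_congr (Equiv.subtypeUnivEquiv fun x => ?_)
    simp
  rw [h1] at hburn
  let m : Ω → ℕ := fun ω => Nat.card (MulAction.orbit G ω.out)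
  let e : Ω → ℕ := fun ω => Nat.card (MulAction.stabilizer G ω.out)
  have hX : Fintype.card X = ∑ ω, m ω := by
    rw [Fintype.card_congr (MulAction.selfEquivSigmaOrbits' G X), Fintype.card_sigma]
    refine Finset.sum_congr rfl fun ω _ => ?_
    rw [← Nat.card_eq_fintype_card]
    refine Nat.card_congr (Equiv.setCongr ?_)
    exact (MulAction.orbitRel.Quotient.orbit_eq_orbit_out ω Quotient.out_eq')
  have hme : ∀ ω, m ω * e ω = n := fun ω => by
    simp only [m, e, hn]
    rw [Nat.card_eq_fintype_card, Nat.card_eq_fintype_card, Nat.card_eq_fintype_card]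
    exact MulAction.card_orbit_mul_card_stabilizer_eq_card_group G _
  have he2 : ∀ ω, 2 ≤ e ω := fun ω => by
    have : Nontrivial (MulAction.stabilizer G ω.out) :=
      (Subgroup.nontrivial_iff_ne_bot _).mpr (hbot _)
    exact Finite.one_lt_card
  have hm3 : ∀ ω, 3 ≤ m ω := fun ω => by
    by_contra! hlt
    refine index_ne_two_of_isSimpleGroup hna (MulAction.stabilizer G ω.out) ⟨?_, htop _⟩
    rw [MulAction.index_stabilizer, ← Nat.card_coe_set_eq]
    simp only [m] at hlt
    omega
  rw [hX] at hburn
  set r := Fintype.card Ω with hr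
  have hle : 2 * ∑ ω, m ω ≤ r * n := by
    rw [Finset.mul_sum, hr, ← smul_eq_mul, ← Finset.card_univ, ← Finset.sum_const]
    refine Finset.sum_le_sum fun ω _ => ?_
    have := hme ω
    have := he2 ω
    nlinarith
  have hge : 3 * r ≤ ∑ ω, m ω := by
    rw [mul_comm, hr, ← smul_eq_mul, ← Finset.card_univ, ← Finset.sum_const]
    exact Finset.sum_le_sum fun ω _ => hm3 ω
  have hr3 : r = 3 := by
    have hlt : r < 4 := by
      by_contra! h4
      have : 4 * n ≤ r * n := Nat.mul_le_mul_right _ h4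
      omega
    interval_cases r <;> omega
  obtain ⟨p, q, hpq⟩ : ∃ f : Fin 3 ≃ Ω, e (f 0) ≤ e (f 1) ∧ e (f 1) ≤ e (f 2) := by
    let f : Fin 3 ≃ Ω := (Fintype.equivFinOfCardEq hr3).symm
    refine ⟨(Tuple.sort (e ∘ f)).trans f, ?_, ?_⟩
    · exact Tuple.monotone_sort (e ∘ f) (show (0 : Fin 3) ≤ 1 by decide)
    · exact Tuple.monotone_sort (e ∘ f) (show (1 : Fin 3) ≤ 2 by decide)
  rw [← p.sum_comp, Fin.sum_univ_three, hr3] at hburn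
  have := orbit_sizes_arith (hme (p 0)) (hme (p 1)) (hme (p 2)) (hm3 _)
    (he2 _) q hpq (by omega)
  rcases this with h | h | h
  · exact (not_isSimpleGroup_of_card_eq_two_pow_mul_three (G := G) (k := 2) le_rfl
      (by rw [← hn, h]; norm_num)).elim
  · exact (not_isSimpleGroup_of_card_eq_two_pow_mul_three (G := G) (k := 3) (by norm_num)
      (by rw [← hn, h]; norm_num)).elim
  · exact h

theorem card_eq_sixty_of_two_fixed_points_infinite {G P : Type*} [Group G] [Finite G]
    [IsSimpleGroup G] (hna : ∃ a b : G, a * b ≠ b * a) [MulAction G P]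
    (h2 : ∀ g : G, g ≠ 1 → (MulAction.fixedBy P g).ncard = 2)
    (htop : ∀ x : P, MulAction.stabilizer G x ≠ ⊤) : Nat.card G = 60 := by
  classical
  let X : SubMulAction G P :=
    { carrier := {p | MulAction.stabilizer G p ≠ ⊥}
      smul_mem' := fun g p hp h => hp (by
        rw [MulAction.stabilizer_smul_eq_stabilizer_map_conj] at h
        exact (Subgroup.map_eq_bot_iff_of_injective _ (MulAut.conj g).injective).mp h) }
  have hmem : ∀ p : P, p ∈ X ↔ ∃ g : G, g ≠ 1 ∧ g • p = p := fun p => by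
    change MulAction.stabilizer G p ≠ ⊥ ↔ _
    rw [Ne, Subgroup.eq_bot_iff_forall]
    push Not
    simp only [MulAction.mem_stabilizer_iff]
    exact exists_congr fun _ => and_comm
  have hfin : Finite X := by
    have : (X : Set P) ⊆ ⋃ g ∈ {g : G | g ≠ 1}, MulAction.fixedBy P g := fun p hp => by
      obtain ⟨g, hg, h⟩ := (hmem p).mp hp
      exact Set.mem_biUnion (x := g) hg h
    refine ((Set.toFinite _).biUnion fun g hg => ?_).subset this
    exact Set.finite_of_ncard_ne_zero (by rw [h2 g hg]; norm_num)
  have hst : ∀ x : X, MulAction.stabilizer G x = MulAction.stabilizer G (x : P) := fun x =>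
    SubMulAction.stabilizer_of_subMul x
  refine card_eq_sixty_of_two_fixed_points (X := X) hna (fun g hg => ?_) (fun x => ?_) fun x => ?_
  · rw [← h2 g hg, ← Nat.card_coe_set_eq]
    refine Nat.card_congr
      ⟨fun x => ⟨x.1.1, ?_⟩, fun p => ⟨⟨p.1, (hmem _).mpr ⟨g, hg, p.2⟩⟩, ?_⟩, ?_, ?_⟩
    · exact congrArg Subtype.val x.2
    · exact Subtype.ext p.2
    · intro x; rfl
    · intro x; rfl
  · rw [hst]; exact x.2
  · rw [hst]; exact htop _

section Moebius

open Matrix Matrix.GeneralLinearGroup OnePoint Polynomial Classical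

variable {k F : Type*} [Field k] [Field F] [Algebra k F]

theorem moebius_scalar_of_smul_transcendental {s : F} (hs : Transcendental k s)
    (g : GL (Fin 2) k) (h : (g.map (algebraMap k F)) • (s : OnePoint F) = s) :
    g.val ∈ Set.range (Matrix.scalar (Fin 2)) := by
  rw [← fixpointPolynomial_eq_zero_iff]
  rw [← fixpointPolynomial_aeval_eq_zero_iff] at h
  by_contra hne
  refine hs ⟨g.fixpointPolynomial, hne, ?_⟩
  rw [← h]
  simp [fixpointPolynomial]

theorem moebius_smul_of_scalar {g : GL (Fin 2) k}
    (hg : g.val ∈ Set.range (Matrix.scalar (Fin 2))) (p : OnePoint k) : g • p = p := by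
  rw [← fixpointPolynomial_eq_zero_iff] at hg
  cases p with
  | infty =>
    rw [smul_infty_eq_self_iff]
    simpa [fixpointPolynomial] using congr_arg (coeff · 2) hg
  | coe c => rw [← fixpointPolynomial_aeval_eq_zero_iff, hg, map_zero]

theorem moebius_scalar_iff [Infinite k] {g : GL (Fin 2) k} :
    g.val ∈ Set.range (Matrix.scalar (Fin 2)) ↔ ∀ p : OnePoint k, g • p = p := by
  refine ⟨moebius_smul_of_scalar, fun h => ?_⟩
  rw [← fixpointPolynomial_eq_zero_iff]
  refine Polynomial.funext fun c => ?_
  have := fixpointPolynomial_aeval_eq_zero_iff.mpr (h c)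
  rwa [eval_zero, ← coe_aeval_eq_eval]

theorem moebius_ncard_fixed {k : Type*} [Field k] [IsAlgClosed k] [CharZero k] {g : GL (Fin 2) k}
    (hg : g.val ∉ Set.range (Matrix.scalar (Fin 2))) (hp : ¬ g.IsParabolic) :
    {p : OnePoint k | g • p = p}.ncard = 2 := by
  have hd : g.val.discr ≠ 0 := fun h => hp ⟨hg, h⟩
  rw [discr_fin_two, trace_fin_two, det_fin_two] at hd
  have hfix : ∀ c : k, g • (c : OnePoint k) = c ↔
      g 1 0 * (c * c) + (g 1 1 - g 0 0) * c + (- g 0 1) = 0 := fun c => by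
    rw [← fixpointPolynomial_aeval_eq_zero_iff]
    simp only [fixpointPolynomial, map_sub, map_mul, map_add, aeval_X_pow, aeval_C, aeval_X,
      Algebra.algebraMap_self_apply]
    ring_nf
  by_cases h0 : g 1 0 = 0
  · have h1 : g 1 1 - g 0 0 ≠ 0 := fun h => hd (by
      change (g 0 0 + g 1 1) ^ 2 - 4 * (g 0 0 * g 1 1 - g 0 1 * g 1 0) = 0
      rw [h0]; linear_combination (g 1 1 - g 0 0) * h)
    have : {p : OnePoint k | g • p = p} = {∞, ((g 0 1 / (g 1 1 - g 0 0) : k) : OnePoint k)} := by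
      ext p
      cases p with
      | infty => simp [smul_infty_eq_self_iff, h0]
      | coe c =>
        simp only [Set.mem_ofPred_eq, hfix, h0, Set.mem_insert_iff, Set.mem_singleton_iff,
          coe_ne_infty, false_or, coe_eq_coe, eq_div_iff h1]
        grind
    rw [this, Set.ncard_pair (infty_ne_coe _)]
  · obtain ⟨d, hd2⟩ := IsAlgClosed.exists_pow_nat_eq
      (discrim (g 1 0) (g 1 1 - g 0 0) (- g 0 1)) (n := 2) (by norm_num)
    have hd0 : d ≠ 0 := by
      rintro rfl
      apply hd
      change (g 0 0 + g 1 1) ^ 2 - 4 * (g 0 0 * g 1 1 - g 0 1 * g 1 0) = 0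
      rw [discrim] at hd2
      linear_combination -hd2
    have h2 : (2 : k) ≠ 0 := two_ne_zero
    have : {p : OnePoint k | g • p = p} =
        {(((-(g 1 1 - g 0 0) + d) / (2 * g 1 0) : k) : OnePoint k),
          (((-(g 1 1 - g 0 0) - d) / (2 * g 1 0) : k) : OnePoint k)} := by
      ext p
      cases p with
      | infty => simp [smul_infty_eq_self_iff, h0]
      | coe c =>
        simp only [Set.mem_ofPred_eq, hfix, Set.mem_insert_iff, Set.mem_singleton_iff, coe_eq_coe]
        exact quadratic_eq_zero_iff h0 (by rw [← hd2]; ring) c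
    rw [this, Set.ncard_pair]
    intro h
    rw [OnePoint.coe_eq_coe, div_left_inj' (mul_ne_zero h2 h0)] at h
    exact hd0 (mul_left_cancel₀ h2 (by linear_combination h))

theorem moebius_exists_smul_infty (p : OnePoint k) :
    ∃ g : GL (Fin 2) k, g • (∞ : OnePoint k) = p := by
  cases p with
  | infty => exact ⟨1, one_smul _ _⟩
  | coe c =>
    refine ⟨GeneralLinearGroup.mkOfDetNeZero !![c, -1; 1, 0] (by simp [det_fin_two]), ?_⟩
    rw [smul_infty_eq_ite]
    simp [GeneralLinearGroup.mkOfDetNeZero]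

theorem moebius_not_isParabolic [CharZero k] {g : GL (Fin 2) k} {n : ℕ} (hn : n ≠ 0)
    (h : (g ^ n).val ∈ Set.range (Matrix.scalar (Fin 2))) : ¬ g.IsParabolic :=
  fun hp => (hp.pow hn).1 h

theorem moebius_commutator_scalar [CharZero k] {g h : GL (Fin 2) k} {p : OnePoint k}
    (hg : g • p = p) (hh : h • p = p) (hnp : ¬ (g * h * g⁻¹ * h⁻¹).IsParabolic) :
    (g * h * g⁻¹ * h⁻¹).val ∈ Set.range (Matrix.scalar (Fin 2)) := by
  obtain ⟨a, rfl⟩ := moebius_exists_smul_infty p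
  have key : ∀ x : GL (Fin 2) k, x • a • (∞ : OnePoint k) = a • (∞ : OnePoint k) →
      (a⁻¹ * x * a) 1 0 = 0 := fun x hx => by
    rw [← smul_infty_eq_self_iff, mul_smul, mul_smul, hx, inv_smul_smul]
  have hG := key g hg
  have hH := key h hh
  have hC := key (g * h * g⁻¹ * h⁻¹) (by
    have hg' : g⁻¹ • a • (∞ : OnePoint k) = a • (∞ : OnePoint k) := by
      rw [inv_smul_eq_iff, hg]
    have hh' : h⁻¹ • a • (∞ : OnePoint k) = a • (∞ : OnePoint k) := by
      rw [inv_smul_eq_iff, hh]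
    rw [mul_smul, mul_smul, mul_smul, hh', hg', hh, hg])
  set G := a⁻¹ * g * a with hGd
  set H := a⁻¹ * h * a with hHd
  set C := a⁻¹ * (g * h * g⁻¹ * h⁻¹) * a with hCd
  have hrel : C * (H * G) = G * H := by rw [hCd, hHd, hGd]; group
  have e00 : C 0 0 * (H 0 0 * G 0 0) = G 0 0 * H 0 0 := by
    have := congrArg (fun m : GL (Fin 2) k => m 0 0) hrel
    simpa [Matrix.mul_apply, Fin.sum_univ_two, hG, hH, hC] using this
  have e11 : C 1 1 * (H 1 1 * G 1 1) = G 1 1 * H 1 1 := by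
    have := congrArg (fun m : GL (Fin 2) k => m 1 1) hrel
    simpa [Matrix.mul_apply, Fin.sum_univ_two, hG, hH, hC] using this
  have hd : ∀ x : GL (Fin 2) k, x 1 0 = 0 → x 0 0 ≠ 0 ∧ x 1 1 ≠ 0 := fun x hx => by
    have := x.det_ne_zero
    rw [det_fin_two] at this
    constructor <;> intro h0 <;> apply this
    · rw [hx, h0]; ring
    · rw [hx, h0]; ring
  have c00 : C 0 0 = 1 := by
    refine mul_right_cancel₀ (mul_ne_zero (hd H hH).1 (hd G hG).1) ?_
    rw [e00, one_mul, mul_comm]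
  have c11 : C 1 1 = 1 := by
    refine mul_right_cancel₀ (mul_ne_zero (hd H hH).2 (hd G hG).2) ?_
    rw [e11, one_mul, mul_comm]
  have hCp : ¬ C.IsParabolic := by
    have := isParabolic_conj_iff' a (g * h * g⁻¹ * h⁻¹)
    rw [hCd]
    rwa [this]
  rw [GeneralLinearGroup.isParabolic_iff_of_upperTriangular hC, c00, c11] at hCp
  have c01 : C 0 1 = 0 := by simpa using hCp
  have hC1 : C = 1 := by
    ext i j
    fin_cases i <;> fin_cases j <;> simp [c00, c11, c01, hC]
  have : g * h * g⁻¹ * h⁻¹ = 1 := by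
    rw [hCd] at hC1
    have := congrArg (fun x => a * x * a⁻¹) hC1
    simpa [mul_assoc] using this
  rw [this]
  exact ⟨1, by simp⟩

theorem moebius_exists_of_adjoin_eq_top {s t : F} (hs : Transcendental k s)
    (hst : k⟮s⟯ = ⊤) (htt : k⟮t⟯ = ⊤) :
    ∃ g : GL (Fin 2) k, (g.map (algebraMap k F)) • (s : OnePoint F) = (t : OnePoint F) := by
  let e : RatFunc k ≃ₐ[k] F := (RatFunc.algEquivOfTranscendental s hs).trans
    ((IntermediateField.equivOfEq hst).trans IntermediateField.topEquiv)
  have he : ∀ q : k[X], e (algebraMap k[X] (RatFunc k) q) = aeval s q := fun q => by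
    simp [e, RatFunc.algEquivOfTranscendental_algebraMap]
  set f : RatFunc k := e.symm t with hf
  have hft : e f = t := by simp [hf]
  have hftop : k⟮f⟯ = ⊤ := by
    have h1 : (k⟮t⟯).map (e.symm : F →ₐ[k] RatFunc k) = ⊤ := by
      rw [htt, ← AlgHom.fieldRange_eq_map]
      exact AlgHom.fieldRange_eq_top.mpr e.symm.surjective
    rw [IntermediateField.adjoin_map, Set.image_singleton] at h1
    exact h1
  have hmax := RatFunc.finrank_eq_max_natDegree f
  rw [hftop, IntermediateField.finrank_top] at hmax
  obtain ⟨a, b, hab⟩ := exists_eq_X_add_C_of_natDegree_le_one (p := f.num) (by omega)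
  obtain ⟨c, d, hcd⟩ := exists_eq_X_add_C_of_natDegree_le_one (p := f.denom) (by omega)
  have hnd : f * algebraMap k[X] (RatFunc k) f.denom = algebraMap k[X] (RatFunc k) f.num := by
    have h0 : algebraMap k[X] (RatFunc k) f.denom ≠ 0 :=
      (map_ne_zero_iff _ (RatFunc.algebraMap_injective k)).mpr f.denom_ne_zero
    rw [eq_comm, ← div_eq_iff h0, f.num_div_denom]
  have hden : aeval s f.denom ≠ 0 := fun h =>
    hs ⟨f.denom, f.denom_ne_zero, h⟩
  have ht : t * aeval s f.denom = aeval s f.num := by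
    have := congrArg e hnd
    rwa [map_mul, he, he, hft] at this
  have hdet : a * d - b * c ≠ 0 := by
    intro h0
    have hcop := f.isCoprime_num_denom
    have h1 : C c * f.num = C a * f.denom := by
      rw [hab, hcd]
      have : C (a * d - b * c) = (0 : k[X]) := by rw [h0, map_zero]
      simp only [map_sub, map_mul] at this
      linear_combination -this
    have h2 : C d * f.num = C b * f.denom := by
      rw [hab, hcd]
      have : C (a * d - b * c) = (0 : k[X]) := by rw [h0, map_zero]
      simp only [map_sub, map_mul] at this
      linear_combination X * this
    have hdn : f.denom ∣ C c := hcop.symm.dvd_of_dvd_mul_right ⟨C a, by rw [h1]; ring⟩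
    have hdn2 : f.denom ∣ C d := hcop.symm.dvd_of_dvd_mul_right ⟨C b, by rw [h2]; ring⟩
    have hnn : f.num ∣ C a := hcop.dvd_of_dvd_mul_right ⟨C c, by rw [← h1]; ring⟩
    have hnn2 : f.num ∣ C b := hcop.dvd_of_dvd_mul_right ⟨C d, by rw [← h2]; ring⟩
    have hD : f.denom.natDegree = 0 := by
      by_cases hc0 : c = 0
      · rw [hcd, hc0]; simp
      · have := natDegree_le_of_dvd hdn (by simpa using hc0)
        simpa using this
    have hN : f.num.natDegree = 0 := by
      by_cases hc0 : a = 0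
      · rw [hab, hc0]; simp
      · have := natDegree_le_of_dvd hnn (by simpa using hc0)
        simpa using this
    rw [hD, hN] at hmax
    simp at hmax
  refine ⟨GeneralLinearGroup.mkOfDetNeZero !![a, b; c, d] (by simpa [det_fin_two] using hdet), ?_⟩
  rw [smul_some_eq_ite]
  have hcd' : algebraMap k F c * s + algebraMap k F d = aeval s f.denom := by
    rw [hcd]; simp
  have hab' : algebraMap k F a * s + algebraMap k F b = aeval s f.num := by
    rw [hab]; simp
  rw [← hcd', ← hab'] at ht
  rw [← hcd'] at hden
  have hg : ∀ i j, ((GeneralLinearGroup.mkOfDetNeZero !![a, b; c, d]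
      (by simpa [det_fin_two] using hdet)).map (algebraMap k F)) i j =
      algebraMap k F (!![a, b; c, d] i j) := fun i j => rfl
  rw [hg, hg, hg, hg]
  simp only [of_apply, cons_val', cons_val_zero, cons_val_one, cons_val_fin_one]
  rw [if_neg hden, OnePoint.coe_eq_coe, div_eq_iff hden, ht]

theorem card_eq_sixty_of_adjoin_eq_top {F : Type*} [Field F] {k : Type*} [Field k] [IsAlgClosed k]
    [CharZero k] [Algebra k F] {G : Type*}
    [Group G] [Finite G] [IsSimpleGroup G] (hna : ∃ a b : G, a * b ≠ b * a)
    {s : F} (hs : Transcendental k s) (hst : k⟮s⟯ = ⊤) (ρ : G →* (F ≃ₐ[k] F))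
    (hρ : Function.Injective ρ) : Nat.card G = 60 := by
  have hgen : ∀ g : G, k⟮ρ g s⟯ = ⊤ := fun g => by
    have h1 : (k⟮s⟯).map (ρ g : F →ₐ[k] F) = ⊤ := by
      rw [hst, ← AlgHom.fieldRange_eq_map]
      exact AlgHom.fieldRange_eq_top.mpr (ρ g).surjective
    rw [IntermediateField.adjoin_map, Set.image_singleton] at h1
    exact h1
  choose M hM using fun g : G => moebius_exists_of_adjoin_eq_top hs hst (hgen g⁻¹)
  have hcomm : ∀ (φ : F ≃ₐ[k] F) (g : GL (Fin 2) k) (x : OnePoint F),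
      OnePoint.map φ (g.map (algebraMap k F) • x) =
        g.map (algebraMap k F) • OnePoint.map φ x := fun φ g x => by
    have := OnePoint.map_smul (φ : F →+* F) (g.map (algebraMap k F)) x
    have h2 : (g.map (algebraMap k F)).map (φ : F →+* F) = g.map (algebraMap k F) := by
      ext i j; simp
    rw [h2] at this
    exact this
  have hsc : ∀ g h : G, ((M g * M h)⁻¹ * M (g * h)).val ∈ Set.range (Matrix.scalar (Fin 2)) :=
    fun g h => by
    refine moebius_scalar_of_smul_transcendental hs _ ?_
    rw [map_mul, mul_smul, hM, map_inv, inv_smul_eq_iff, map_mul, mul_smul, hM h]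
    have := congrArg (OnePoint.map (ρ h⁻¹)) (hM g)
    rw [hcomm, OnePoint.map_some, OnePoint.map_some] at this
    rw [this, _root_.mul_inv_rev, map_mul]
    rfl
  have hmul : ∀ (g h : G) (p : OnePoint k), M (g * h) • p = M g • M h • p := fun g h p => by
    have := moebius_smul_of_scalar (hsc g h) p
    rwa [mul_smul, inv_smul_eq_iff, mul_smul] at this
  have hone : ∀ g : G, (M g).val ∈ Set.range (Matrix.scalar (Fin 2)) ↔ g = 1 := fun g => by
    refine ⟨fun h => ?_, fun h => ?_⟩
    · have h1 : ((M g).map (algebraMap k F)).val ∈ Set.range (Matrix.scalar (Fin 2)) := by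
        obtain ⟨c, hc⟩ := h
        refine ⟨algebraMap k F c, ?_⟩
        ext i j
        have := congrArg (fun m : Matrix (Fin 2) (Fin 2) k => algebraMap k F (m i j)) hc
        simp only [GeneralLinearGroup.map_apply]
        rw [← this]
        by_cases hij : i = j <;> simp [hij]
      have h2 := moebius_smul_of_scalar h1 (s : OnePoint F)
      rw [hM, OnePoint.coe_eq_coe] at h2
      have h3 : ρ g⁻¹ = 1 := by
        have hle : (⊤ : IntermediateField k F) ≤
            IntermediateField.fixedField (Subgroup.zpowers (ρ g⁻¹)) := by
          rw [← hst, IntermediateField.adjoin_simple_le_iff]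
          rintro ⟨x, hx⟩
          have hst : ∀ x ∈ Subgroup.zpowers (ρ g⁻¹), x • s = s := by
            have : Subgroup.zpowers (ρ g⁻¹) ≤ MulAction.stabilizer (F ≃ₐ[k] F) s := by
              rw [Subgroup.zpowers_le]; exact h2
            exact fun x hx => this hx
          exact hst x hx
        ext y
        exact hle (x := y) trivial ⟨ρ g⁻¹, Subgroup.mem_zpowers _⟩
      rw [← map_one ρ] at h3
      exact inv_eq_one.mp (hρ h3)
    · subst h
      refine moebius_scalar_of_smul_transcendental hs _ ?_
      rw [hM]; simp
  let _ : MulAction G (OnePoint k) :=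
    { smul := fun g p => M g • p
      one_smul := fun p => moebius_smul_of_scalar ((hone 1).mpr rfl) p
      mul_smul := fun g h p => hmul g h p }
  have hsmul : ∀ (g : G) (p : OnePoint k), M g • p = g • p := fun _ _ => rfl
  have hinv : ∀ (g : G) (p : OnePoint k), (M g)⁻¹ • p = g⁻¹ • p := fun g p => by
    rw [inv_smul_eq_iff, hsmul, smul_inv_smul]
  have hscal : ∀ (g : G) (x : GL (Fin 2) k), (∀ p : OnePoint k, x • p = g • p) →
      (x.val ∈ Set.range (Matrix.scalar (Fin 2)) ↔ g = 1) := fun g x hx => by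
    rw [moebius_scalar_iff, ← hone, moebius_scalar_iff]
    simp only [hx, hsmul]
  have hfin : ∀ (g : G) (x : GL (Fin 2) k), (∀ p : OnePoint k, x • p = g • p) →
      ¬ x.IsParabolic := fun g x hx => by
    refine moebius_not_isParabolic (n := Nat.card G) Nat.card_pos.ne' ?_
    have hxp : ∀ (n : ℕ) (p : OnePoint k), x ^ n • p = g ^ n • p := fun n => by
      induction n with
      | zero => simp
      | succ n ih => intro p; rw [pow_succ, pow_succ, mul_smul, mul_smul, ih, hx]
    rw [hscal _ _ (hxp _), pow_card_eq_one']
  refine card_eq_sixty_of_two_fixed_points_infinite (P := OnePoint k) hna (fun g hg => ?_)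
    fun p hp => ?_
  · exact moebius_ncard_fixed (mt (hone g).mp hg) (hfin g (M g) (hsmul g))
  · obtain ⟨a, b, hab⟩ := hna
    have hfix : ∀ g : G, M g • p = p := fun g => by
      have : g ∈ MulAction.stabilizer G p := hp ▸ Subgroup.mem_top g
      exact this
    have hact : ∀ q : OnePoint k, (M a * M b * (M a)⁻¹ * (M b)⁻¹) • q = (a * b * a⁻¹ * b⁻¹) • q :=
      fun q => by simp only [mul_smul, hinv, hsmul]
    have := moebius_commutator_scalar (hfix a) (hfix b) (hfin _ _ hact)
    rw [hscal _ _ hact] at this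
    rw [mul_inv_eq_one, mul_inv_eq_iff_eq_mul] at this
    exact hab this

end Moebius

section FunctionFieldDegree

open Polynomial Cardinal

variable {k E : Type} [Field k] [Field E] [Algebra k E]

theorem isAlgebraic_adjoin_simple_of_trdeg_le_one (h1 : Algebra.trdeg k E ≤ 1) {x : E}
    (hx : Transcendental k x) : Algebra.IsAlgebraic k⟮x⟯ E := by
  have hi : AlgebraicIndependent k (fun _ : Unit => x) :=
    algebraicIndependent_unique_type_iff.mpr hx
  have hb := hi.isTranscendenceBasis_of_trdeg_le_of_finite (by simpa using h1)
  have := hb.isAlgebraic_field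
  rwa [Set.range_const] at this

theorem finiteDimensional_adjoin_simple [Algebra.EssFiniteType k E] (h1 : Algebra.trdeg k E ≤ 1)
    {x : E} (hx : Transcendental k x) : FiniteDimensional k⟮x⟯ E := by
  have := isAlgebraic_adjoin_simple_of_trdeg_le_one h1 hx
  have : Algebra.EssFiniteType k⟮x⟯ E := Algebra.EssFiniteType.of_comp k _ _
  exact Algebra.finite_of_essFiniteType_of_isAlgebraic

theorem trdeg_le_one_of_isAlgebraic_adjoin_simple {x : E} [h : Algebra.IsAlgebraic k⟮x⟯ E] :
    Algebra.trdeg k E ≤ 1 := by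
  have : Algebra.IsAlgebraic (Algebra.adjoin k {x}) E := isAlgebraic_adjoin_iff_top.mp h
  simpa using Algebra.IsAlgebraic.trdeg_le_cardinalMk k {x}

theorem transcendental_of_forall_algebraMap_ne [IsAlgClosed k] {x : E}
    (hx : ∀ c : k, algebraMap k E c ≠ x) : Transcendental k x := by
  intro h
  have : Algebra.IsIntegral k k⟮x⟯ :=
    (isAlgebraic_adjoin_simple h.isIntegral).isIntegral
  obtain ⟨c, hc⟩ := (IsAlgClosed.algebraMap_bijective_of_isIntegral (k := k)
    (K := k⟮x⟯)).2 (AdjoinSimple.gen k x)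
  exact hx c (by simpa using congrArg (algebraMap k⟮x⟯ E) hc)

/-- The field `k(x)` as an algebra over `k[X]`, the variable acting as `x`. -/
noncomputable abbrev polynomialAlgebraAdjoinSimple (x : E) : Algebra k[X] k⟮x⟯ :=
  (aeval (AdjoinSimple.gen k x)).toAlgebra

attribute [local instance] polynomialAlgebraAdjoinSimple

theorem coe_polynomial_algebraMap_adjoin_simple (x : E) (p : k[X]) :
    ((algebraMap k[X] k⟮x⟯ p : k⟮x⟯) : E) = aeval x p := by
  change ((aeval (AdjoinSimple.gen k x) p : k⟮x⟯) : E) = _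
  rw [← IntermediateField.algebraMap_apply, ← Polynomial.aeval_algebraMap_apply]
  simp

theorem injective_polynomial_algebraMap_adjoin_simple {x : E} (hx : Transcendental k x) :
    Function.Injective (algebraMap k[X] k⟮x⟯) := fun p q h =>
  transcendental_iff_injective.mp hx
    (by rw [← coe_polynomial_algebraMap_adjoin_simple,
      ← coe_polynomial_algebraMap_adjoin_simple, h])

theorem isFractionRing_polynomial_adjoin_simple {x : E} (hx : Transcendental k x) :
    IsFractionRing k[X] k⟮x⟯ :=
  have : FaithfulSMul k[X] k⟮x⟯ := (faithfulSMul_iff_algebraMap_injective _ _).mpr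
    (injective_polynomial_algebraMap_adjoin_simple hx)
  .of_field _ _ fun z => by
    obtain ⟨r, s, hrs⟩ := (mem_adjoin_simple_iff k (z : E)).mp z.2
    exact ⟨r, s, Subtype.ext (by
      rw [hrs, IntermediateField.coe_div, coe_polynomial_algebraMap_adjoin_simple,
        coe_polynomial_algebraMap_adjoin_simple])⟩

theorem aeval_map_polynomial_algebraMap (x y : E) (P : k[X][X]) :
    aeval y (P.map (algebraMap k[X] k⟮x⟯)) = P.aevalAeval x y := by
  induction P using Polynomial.induction_on' with
  | add p q hp hq => rw [Polynomial.map_add, map_add, map_add, hp, hq]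
  | monomial n a =>
    rw [map_monomial, aeval_monomial, IntermediateField.algebraMap_apply,
      coe_polynomial_algebraMap_adjoin_simple]
    simp

theorem natDegree_minpoly_eq_of_irreducible {x y : E} (hx : Transcendental k x)
    {P : k[X][X]} (hP : Irreducible P) (hP0 : P.natDegree ≠ 0) (h0 : P.aevalAeval x y = 0) :
    (minpoly k⟮x⟯ y).natDegree = P.natDegree := by
  have hinj := injective_polynomial_algebraMap_adjoin_simple hx
  have := isFractionRing_polynomial_adjoin_simple hx
  have hirr : Irreducible (P.map (algebraMap k[X] k⟮x⟯)) :=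
    ((hP.isPrimitive hP0).irreducible_iff_irreducible_map_fraction_map).mp hP
  have hroot : aeval y (P.map (algebraMap k[X] k⟮x⟯)) = 0 := by
    rw [aeval_map_polynomial_algebraMap, h0]
  rw [← minpoly.eq_of_irreducible hirr hroot, natDegree_mul_C
    (inv_ne_zero (leadingCoeff_ne_zero.mpr hirr.ne_zero)), natDegree_map_eq_of_injective hinj]

theorem finrank_adjoin_simple_eq_mul {x y : E} (hy : IsAlgebraic k⟮x⟯ y) :
    Module.finrank k⟮x⟯ E = (minpoly k⟮x⟯ y).natDegree * Module.finrank k⟮x, y⟯ E := by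
  rw [← adjoin_simple_adjoin_simple, ← adjoin.finrank hy.isIntegral]
  exact (Module.finrank_mul_finrank k⟮x⟯ k⟮x⟯⟮y⟯ E).symm

theorem exists_aevalAeval_eq_zero {x y : E} (hx : Transcendental k x)
    (hy : IsAlgebraic k⟮x⟯ y) : ∃ P : k[X][X], P ≠ 0 ∧ P.aevalAeval x y = 0 := by
  have := isFractionRing_polynomial_adjoin_simple hx
  obtain ⟨p, hp, hp0⟩ := hy
  refine ⟨IsLocalization.integerNormalization (nonZeroDivisors k[X]) p,
    fun h0 => hp (IsFractionRing.integerNormalization_eq_zero_iff.mp h0), ?_⟩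
  obtain ⟨b, -, hb⟩ := IsLocalization.integerNormalization_spec (nonZeroDivisors k[X]) p
  rw [← aeval_map_polynomial_algebraMap, hb, ← algebraMap_smul k⟮x⟯ b p, map_smul, hp0,
    smul_zero]

theorem exists_irreducible_aevalAeval_eq_zero {x y : E} (hx : Transcendental k x)
    (hy : IsAlgebraic k⟮x⟯ y) : ∃ P : k[X][X], Irreducible P ∧ P.aevalAeval x y = 0 := by
  obtain ⟨P, hP, hP0⟩ := exists_aevalAeval_eq_zero hx hy
  have hprime : (RingHom.ker (aevalAeval x y : k[X][X] →ₐ[k] E)).IsPrime :=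
    RingHom.ker_isPrime _
  obtain ⟨Q, hQ, hQp⟩ := hprime.exists_mem_prime_of_ne_bot (fun h => hP (by
    have : P ∈ RingHom.ker (aevalAeval x y : k[X][X] →ₐ[k] E) := hP0
    rwa [h, Ideal.mem_bot] at this))
  exact ⟨Q, hQp.irreducible, hQ⟩

theorem natDegree_ne_zero_of_aevalAeval_eq_zero {x y : E} (hx : Transcendental k x)
    {P : k[X][X]} (hP : P ≠ 0) (h0 : P.aevalAeval x y = 0) : P.natDegree ≠ 0 := by
  intro h
  rw [natDegree_eq_zero] at h
  obtain ⟨p, rfl⟩ := h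
  rw [aevalAeval_C] at h0
  exact hP (by rw [transcendental_iff.mp hx p h0, C_0])

/-- The degree of the rational function `x` is an upper bound for the degree in the second
variable of its irreducible relation with `y`, up to the common factor. -/
theorem finrank_adjoin_simple_eq_natDegree_mul {x y : E} (hx : Transcendental k x)
    (hy : IsAlgebraic k⟮x⟯ y) {P : k[X][X]} (hP : Irreducible P) (h0 : P.aevalAeval x y = 0) :
    Module.finrank k⟮x⟯ E = P.natDegree * Module.finrank k⟮x, y⟯ E := by
  rw [finrank_adjoin_simple_eq_mul hy, natDegree_minpoly_eq_of_irreducible hx hP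
    (natDegree_ne_zero_of_aevalAeval_eq_zero hx hP.ne_zero h0) h0]

theorem coeff_coeff_swap (P : k[X][X]) (i j : ℕ) :
    ((Bivariate.swap P).coeff i).coeff j = (P.coeff j).coeff i := by
  induction P using Polynomial.induction_on' with
  | add p q hp hq => simp only [map_add, coeff_add, hp, hq]
  | monomial n a =>
    induction a using Polynomial.induction_on' with
    | add p q hp hq => simp only [map_add, coeff_add, hp, hq]
    | monomial m a =>
      rw [Bivariate.swap_monomial_monomial]
      simp only [coeff_monomial]
      split_ifs <;> simp [coeff_monomial, *]

theorem natDegree_coeff_le_natDegree_swap (P : k[X][X]) (j : ℕ) :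
    (P.coeff j).natDegree ≤ (Bivariate.swap P).natDegree := by
  refine natDegree_le_iff_coeff_eq_zero.mpr fun i hi => ?_
  rw [← coeff_coeff_swap, coeff_eq_zero_of_natDegree_lt hi, coeff_zero]

theorem natDegree_minpoly_mul_le {x y : E} (hz : Transcendental k (x * y)) {P : k[X][X]}
    (hP : P ≠ 0) (h0 : P.aevalAeval x y = 0) :
    (minpoly k⟮x * y⟯ x).natDegree ≤ P.natDegree + (Bivariate.swap P).natDegree := by
  set n := P.natDegree with hn
  set Q : k[X][X] := ∑ j ∈ Finset.range (n + 1), C (P.coeff j * X ^ (n - j)) * X ^ j with hQ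
  have hQ0 : Q ≠ 0 := by
    intro h
    have h1 : Q.coeff n = P.leadingCoeff := by
      rw [hQ, finsetSum_coeff, Finset.sum_eq_single n]
      · rw [coeff_C_mul, coeff_X_pow_self, mul_one, Nat.sub_self, pow_zero, mul_one, hn,
          leadingCoeff]
      · intro j _ hj
        rw [coeff_C_mul, coeff_X_pow, if_neg hj.symm, mul_zero]
      · simp
    rw [h, coeff_zero] at h1
    exact hP (leadingCoeff_eq_zero.mp h1.symm)
  have hQz : Q.aevalAeval x (x * y) = 0 := by
    have h1 : Q.aevalAeval x (x * y) = x ^ n * P.aevalAeval x y := by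
      conv_rhs => rw [P.as_sum_range_C_mul_X_pow, map_sum, Finset.mul_sum]
      rw [hQ, map_sum]
      refine Finset.sum_congr rfl fun j hj => ?_
      have hj' : n - j + j = n := Nat.sub_add_cancel (Nat.lt_succ_iff.mp (Finset.mem_range.mp hj))
      simp only [map_mul, map_pow, aevalAeval_C, aevalAeval_Y, aeval_X]
      rw [mul_pow, ← hj', pow_add]
      simp only [Nat.add_sub_cancel]
      ring
    rw [h1, h0, mul_zero]
  have hinj := injective_polynomial_algebraMap_adjoin_simple hz
  have hR : Bivariate.swap Q ≠ 0 := fun h => hQ0 ((map_eq_zero_iff _ Bivariate.swap.injective).mp h)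
  have hroot : aeval x ((Bivariate.swap Q).map (algebraMap k[X] k⟮x * y⟯)) = 0 := by
    rw [aeval_map_polynomial_algebraMap, Bivariate.aevalAeval_swap, hQz]
  have hne : (Bivariate.swap Q).map (algebraMap k[X] k⟮x * y⟯) ≠ 0 :=
    (Polynomial.map_ne_zero_iff hinj).mpr hR
  refine (natDegree_le_natDegree (minpoly.degree_le_of_ne_zero _ _ hne hroot)).trans ?_
  refine natDegree_map_le.trans ?_
  refine natDegree_le_iff_coeff_eq_zero.mpr fun i hi => ?_
  ext j
  rw [coeff_coeff_swap, coeff_zero, hQ, finsetSum_coeff, finsetSum_coeff]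
  refine Finset.sum_eq_zero fun l _ => ?_
  rw [coeff_C_mul, coeff_X_pow]
  split_ifs with hjl
  · rw [mul_one]
    refine coeff_eq_zero_of_natDegree_lt (lt_of_le_of_lt natDegree_mul_le ?_)
    have := natDegree_coeff_le_natDegree_swap P l
    rw [natDegree_X_pow]
    omega
  · simp

theorem finrank_adjoin_mul_le {x y : E} (h1 : Algebra.trdeg k E ≤ 1)
    (hx : Transcendental k x) (hy : Transcendental k y) (hz : Transcendental k (x * y)) :
    Module.finrank k⟮x * y⟯ E ≤ Module.finrank k⟮x⟯ E + Module.finrank k⟮y⟯ E := by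
  have hyx := (isAlgebraic_adjoin_simple_of_trdeg_le_one h1 hx).isAlgebraic y
  have hxy := (isAlgebraic_adjoin_simple_of_trdeg_le_one h1 hy).isAlgebraic x
  have hxz := (isAlgebraic_adjoin_simple_of_trdeg_le_one h1 hz).isAlgebraic x
  obtain ⟨P, hP, h0⟩ := exists_irreducible_aevalAeval_eq_zero hx hyx
  have hs0 : (Bivariate.swap P).aevalAeval y x = 0 := by rw [Bivariate.aevalAeval_swap, h0]
  have hS : Irreducible (Bivariate.swap P) := (MulEquiv.irreducible_iff Bivariate.swap).mpr hP
  have hx0 : x ≠ 0 := fun h => hx (h ▸ isAlgebraic_zero)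
  have hzx : k⟮x * y, x⟯ = k⟮x, y⟯ := by
    apply le_antisymm <;> refine adjoin_le_iff.mpr ?_
    · rintro _ (rfl | rfl)
      · exact mul_mem (subset_adjoin _ _ (by simp)) (subset_adjoin _ _ (by simp))
      · exact subset_adjoin _ _ (by simp)
    · rintro w (hw | hw)
      · exact hw ▸ subset_adjoin _ _ (by simp)
      · have : x * y / x ∈ k⟮x * y, x⟯ :=
          div_mem (subset_adjoin _ _ (by simp)) (subset_adjoin _ _ (by simp))
        rw [mul_div_cancel_left₀ _ hx0] at this
        rw [Set.mem_singleton_iff.mp hw]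
        exact this
  have hyx' : k⟮y, x⟯ = k⟮x, y⟯ := by rw [Set.pair_comm]
  rw [finrank_adjoin_simple_eq_mul hxz, hzx, finrank_adjoin_simple_eq_natDegree_mul hx hyx hP h0,
    finrank_adjoin_simple_eq_natDegree_mul hy hxy hS hs0, hyx', ← add_mul]
  exact Nat.mul_le_mul_right _ (natDegree_minpoly_mul_le hz hP.ne_zero h0)

theorem adjoin_simple_algebraMap_mul {x : E} {c : k} (hc : c ≠ 0) :
    k⟮algebraMap k E c * x⟯ = k⟮x⟯ := by
  apply le_antisymm <;> refine adjoin_simple_le_iff.mpr ?_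
  · exact mul_mem (_root_.algebraMap_mem _ _) (mem_adjoin_simple_self _ _)
  · have := mul_mem (_root_.algebraMap_mem k⟮algebraMap k E c * x⟯ c⁻¹)
      (mem_adjoin_simple_self k (algebraMap k E c * x))
    rwa [← mul_assoc, ← map_mul, inv_mul_cancel₀ hc, map_one, one_mul] at this

end FunctionFieldDegree

section NormDegree

open Polynomial

variable {k E : Type} [Field k] [Field E] [Algebra k E]

theorem adjoin_simple_ext_finrank {x y : E} (h : k⟮x⟯ = k⟮y⟯) :
    Module.finrank k⟮x⟯ E = Module.finrank k⟮y⟯ E := by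
  rw [h]

theorem multiset_prod_degree_le [IsAlgClosed k] (h1 : Algebra.trdeg k E ≤ 1) {r : ℕ}
    (s : Multiset E) (hs : ∀ x ∈ s, Transcendental k x ∧ Module.finrank k⟮x⟯ E ≤ r) :
    (∃ c : k, algebraMap k E c = s.prod) ∨
      Transcendental k s.prod ∧ Module.finrank k⟮s.prod⟯ E ≤ Multiset.card s * r := by
  induction s using Multiset.induction_on with
  | empty => exact Or.inl ⟨1, by simp⟩
  | cons x s ih =>
    by_cases hc : ∃ c : k, algebraMap k E c = (x ::ₘ s).prod
    · exact Or.inl hc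
    right
    have ht : Transcendental k (x ::ₘ s).prod :=
      transcendental_of_forall_algebraMap_ne (by simpa using hc)
    refine ⟨ht, ?_⟩
    obtain ⟨hx, hxr⟩ := hs x (Multiset.mem_cons_self x s)
    rw [Multiset.prod_cons, Multiset.card_cons, add_mul, one_mul] at *
    obtain ⟨c, hc'⟩ | ⟨hp, hpr⟩ := ih fun y hy => hs y (Multiset.mem_cons_of_mem hy)
    · have hc0 : c ≠ 0 := by
        rintro rfl
        rw [← hc', map_zero, mul_zero] at ht
        exact ht isAlgebraic_zero
      rw [← hc', mul_comm, adjoin_simple_ext_finrank (adjoin_simple_algebraMap_mul hc0)]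
      omega
    · have := finrank_adjoin_mul_le h1 hx hp ht
      omega

theorem finrank_adjoin_algebraMap {M : Type} [Field M] [Algebra k M] [Algebra E M]
    [IsScalarTower k E M] (x : E) :
    Module.finrank k⟮algebraMap E M x⟯ M = Module.finrank k⟮x⟯ E * Module.finrank E M := by
  have : IsScalarTower k⟮x⟯ E M := inferInstance
  rw [Module.finrank_mul_finrank]
  let f := IsScalarTower.toAlgHom k E M
  have h : (k⟮x⟯).map f = k⟮algebraMap E M x⟯ := by
    rw [adjoin_map, Set.image_singleton]; rfl
  let e : k⟮x⟯ ≃ₐ[k] k⟮algebraMap E M x⟯ :=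
    ((k⟮x⟯).equivMap f).trans (IntermediateField.equivOfEq h)
  refine (Algebra.finrank_eq_of_equiv_equiv e.toRingEquiv (RingEquiv.refl M) ?_).symm
  ext a
  rfl

theorem exists_eval_not_const [IsAlgClosed k] {F : Type} [Field F] [Algebra k F]
    [Algebra F E] [IsScalarTower k F E] {x : E} (hx : Transcendental k x) {p : F[X]} (hp : p ≠ 0)
    (h0 : aeval x p = 0) : ∃ c : k, Transcendental k (p.eval (algebraMap k F c)) := by
  classical
  by_contra! hcon
  have hval : ∀ c : k, ∃ d : k, algebraMap k F d = p.eval (algebraMap k F c) := by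
    intro c
    by_contra! h
    exact hcon c (transcendental_of_forall_algebraMap_ne h)
  choose v hv using hval
  obtain ⟨s, hs⟩ := Infinite.exists_subset_card_eq k (p.natDegree + 1)
  let q : k[X] := Lagrange.interpolate s id v
  have hq : q.degree < s.card := Lagrange.degree_interpolate_lt _ (Set.injOn_id _)
  have hpq : p = q.map (algebraMap k F) := by
    refine eq_of_degrees_lt_of_eval_index_eq (s := s) (v := algebraMap k F)
      (algebraMap k F).injective.injOn ?_ ?_ ?_
    · rw [hs]
      exact degree_le_natDegree.trans_lt (by exact_mod_cast Nat.lt_succ_self _)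
    · exact degree_map_le.trans_lt hq
    · intro i hi
      rw [eval_map_algebraMap, aeval_algebraMap_apply, ← hv i]
      congr 1
      rw [coe_aeval_eq_eval]
      exact (Lagrange.eval_interpolate_at_node v (Set.injOn_id _) hi).symm
  rw [hpq, aeval_map_algebraMap] at h0
  refine hx ⟨q, ?_, h0⟩
  rintro h
  rw [h, Polynomial.map_zero] at hpq
  exact hp hpq

theorem trdeg_le_one_of_isAlgebraic {M : Type} [Field M] [Algebra k M] [Algebra E M]
    [IsScalarTower k E M] [Algebra.IsAlgebraic E M] (h : Algebra.trdeg k E ≤ 1) :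
    Algebra.trdeg k M ≤ 1 := by
  rw [← trdeg_add_eq k E, trdeg_eq_zero (R := E), add_zero]
  exact h

/-- If the curve with function field `E` carries a rational function of degree `r`, then any
curve dominated by it carries a rational function of degree at most `r`. -/
theorem exists_finrank_adjoin_le [IsAlgClosed k] {F : Type} [Field F] [Algebra k F]
    [Algebra F E] [IsScalarTower k F E] [FiniteDimensional F E] (h1 : Algebra.trdeg k E ≤ 1)
    {x : E} (hx : Transcendental k x) :
    ∃ h : F, Transcendental k h ∧ Module.finrank k⟮h⟯ F ≤ Module.finrank k⟮x⟯ E := by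
  have hint : IsIntegral F x := IsIntegral.of_finite F x
  set p := minpoly F x with hp
  have hirr : Irreducible p := minpoly.irreducible hint
  obtain ⟨c, hc⟩ := exists_eval_not_const hx hirr.ne_zero (minpoly.aeval F x)
  refine ⟨_, hc, ?_⟩
  let N := p.SplittingField
  have hF1 : Algebra.trdeg k F ≤ 1 := (trdeg_le_of_injective
    (IsScalarTower.toAlgHom k F E) (algebraMap F E).injective).trans h1
  have hN1 : Algebra.trdeg k N ≤ 1 := trdeg_le_one_of_isAlgebraic (E := F) hF1
  let x' : F⟮x⟯ := AdjoinSimple.gen F x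
  have ht2 : IsScalarTower k F⟮x⟯ E := .of_algebraMap_eq fun y => by
    rw [IsScalarTower.algebraMap_apply k F F⟮x⟯, ← IsScalarTower.algebraMap_apply F F⟮x⟯ E,
      ← IsScalarTower.algebraMap_apply k F E]
  let q := p.map (algebraMap F N)
  have hq : q.Splits := SplittingField.splits p
  have hqm : q.Monic := (minpoly.monic hint).map _
  have hroot : ∀ α ∈ q.roots, Module.finrank k⟮α⟯ N * p.natDegree =
      Module.finrank k⟮x'⟯ F⟮x⟯ * Module.finrank F N ∧ Transcendental k α := by
    intro α hα
    have hα0 : aeval α p = 0 := by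
      rw [← aeval_map_algebraMap N, coe_aeval_eq_eval]; exact (mem_roots'.mp hα).2
    let σ : F⟮x⟯ →ₐ[F] N := (algHomAdjoinIntegralEquiv F hint).symm
      ⟨α, by rw [mem_aroots]; exact ⟨hirr.ne_zero, hα0⟩⟩
    have hσ : σ x' = α := algHomAdjoinIntegralEquiv_symm_apply_gen F hint _
    let : Algebra F⟮x⟯ N := σ.toRingHom.toAlgebra
    have ht : IsScalarTower F F⟮x⟯ N := .of_algebraMap_eq fun y => (σ.commutes y).symm
    have ht' : IsScalarTower k F⟮x⟯ N := .of_algebraMap_eq fun y => by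
      rw [IsScalarTower.algebraMap_apply k F N, IsScalarTower.algebraMap_apply k F F⟮x⟯,
        ← IsScalarTower.algebraMap_apply F F⟮x⟯ N]
    have h2 := finrank_adjoin_algebraMap (k := k) (M := N) x'
    rw [show algebraMap F⟮x⟯ N x' = α from hσ] at h2
    have h3 := Module.finrank_mul_finrank F F⟮x⟯ N
    rw [adjoin.finrank hint] at h3
    refine ⟨by rw [h2, ← h3]; ring, ?_⟩
    rw [← hσ]
    refine (transcendental_algebraMap_iff (algebraMap F⟮x⟯ N).injective).mpr ?_
    rw [← transcendental_algebraMap_iff (algebraMap F⟮x⟯ E).injective]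
    exact hx
  set a := Module.finrank k⟮x'⟯ F⟮x⟯ with ha
  have hcard : Multiset.card q.roots = p.natDegree := by
    rw [← hq.natDegree_eq_card_roots, natDegree_map]
  have hd : 0 < p.natDegree := minpoly.natDegree_pos hint
  have heval : algebraMap F N (p.eval (algebraMap k F c)) =
      (q.roots.map fun α => algebraMap k N c - α).prod := by
    rw [IsScalarTower.algebraMap_apply k F N, ← eval_map_apply, hq.eval_eq_prod_roots,
      hqm.leadingCoeff, one_mul]
  have hdeg := multiset_prod_degree_le hN1 (r := a * Module.finrank F N / p.natDegree)
    (q.roots.map fun α => algebraMap k N c - α) (by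
      intro y hy
      obtain ⟨α, hα, rfl⟩ := Multiset.mem_map.mp hy
      obtain ⟨h2, h3⟩ := hroot α hα
      have h4 : k⟮algebraMap k N c - α⟯ = k⟮α⟯ := by
        apply le_antisymm <;> refine adjoin_simple_le_iff.mpr ?_
        · exact sub_mem (_root_.algebraMap_mem _ _) (mem_adjoin_simple_self _ _)
        · have := sub_mem (_root_.algebraMap_mem k⟮algebraMap k N c - α⟯ c)
            (mem_adjoin_simple_self k (algebraMap k N c - α))
          rwa [sub_sub_cancel] at this
      refine ⟨fun h => h3 ?_, ?_⟩
      · have := (isAlgebraic_algebraMap (A := N) c).sub h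
        rwa [sub_sub_cancel] at this
      · rw [adjoin_simple_ext_finrank h4, Nat.le_div_iff_mul_le hd, h2])
  rw [← heval, Multiset.card_map, hcard] at hdeg
  obtain ⟨b, hb⟩ | ⟨-, hle⟩ := hdeg
  · refine absurd ?_ hc
    rw [← isAlgebraic_algebraMap_iff (algebraMap F N).injective, ← hb]
    exact isAlgebraic_algebraMap b
  · rw [finrank_adjoin_algebraMap] at hle
    have h5 : Module.finrank k⟮x⟯ E = a * Module.finrank F⟮x⟯ E :=
      finrank_adjoin_algebraMap (E := F⟮x⟯) (M := E) x'
    have h6 : 0 < Module.finrank F⟮x⟯ E := Module.finrank_pos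
    have h7 : 0 < Module.finrank F N := Module.finrank_pos
    have h8 := hle.trans (Nat.mul_div_le _ _)
    rw [h5]
    exact (Nat.le_of_mul_le_mul_right h8 h7).trans (Nat.le_mul_of_pos_right _ h6)

end NormDegree

section Specialization

open Polynomial

theorem sum_mul_pow_injOn {n N : ℕ} {v w : Fin n → ℕ} (hv : ∀ i, v i < N) (hw : ∀ i, w i < N)
    (h : ∑ i, v i * N ^ (i : ℕ) = ∑ i, w i * N ^ (i : ℕ)) : v = w := by
  have : (fun i => (⟨v i, hv i⟩ : Fin N)) = fun i => ⟨w i, hw i⟩ := by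
    apply finFunctionFinEquiv.injective
    apply Fin.ext
    simpa only [finFunctionFinEquiv_apply] using h
  funext i
  exact congrArg Fin.val (congrFun this i)

/-- Kronecker substitution: a polynomial whose total degree is less than `N` is determined by its
value at `X ^ (N ^ i)`. -/
theorem mvPolynomial_aeval_X_pow_pow_ne_zero {k ι : Type} [CommRing k] [Fintype ι] {n N : ℕ}
    (e : ι ≃ Fin n) {p : MvPolynomial ι k} (hp : p ≠ 0) (hN : p.totalDegree < N) :
    MvPolynomial.aeval (fun i => (X : k[X]) ^ N ^ (e i : ℕ)) p ≠ 0 := by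
  classical
  obtain ⟨m, hm⟩ := MvPolynomial.support_nonempty.mpr hp
  have hlt : ∀ m ∈ p.support, ∀ i, m i < N := fun m hm i =>
    ((Finsupp.le_degree i m).trans (MvPolynomial.le_totalDegree hm)).trans_lt hN
  have hval : MvPolynomial.aeval (fun i => (X : k[X]) ^ N ^ (e i : ℕ)) p =
      ∑ m ∈ p.support, C (p.coeff m) * X ^ ∑ i : Fin n, m (e.symm i) * N ^ (i : ℕ) := by
    rw [MvPolynomial.aeval_def, MvPolynomial.eval₂_eq']
    refine Finset.sum_congr rfl fun m _ => ?_
    congr 1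
    rw [← Finset.prod_pow_eq_pow_sum, ← e.prod_comp]
    refine Finset.prod_congr rfl fun i _ => ?_
    rw [← pow_mul, Equiv.symm_apply_apply, mul_comm]
  intro h0
  have hc := congrArg (fun f => Polynomial.coeff f (∑ i : Fin n, m (e.symm i) * N ^ (i : ℕ)))
    (hval.symm.trans h0)
  simp only [Polynomial.finsetSum_coeff, Polynomial.coeff_C_mul_X_pow, Polynomial.coeff_zero] at hc
  rw [Finset.sum_eq_single m] at hc
  · rw [if_pos rfl] at hc
    exact MvPolynomial.mem_support_iff.mp hm hc
  · intro m' hm' hne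
    refine if_neg fun h => hne ?_
    have := sum_mul_pow_injOn (fun i => hlt m hm _) (fun i => hlt m' hm' _) h
    ext i
    simpa using (congrFun this (e i)).symm
  · exact fun h => absurd hm h

/-- Specializing the coefficients of the minimal polynomial of an integral element. -/
theorem exists_adjoin_specialization {A K L M : Type} [CommRing A] [IsDomain A]
    [IsIntegrallyClosed A] [Field K] [Algebra A K] [IsFractionRing A K] [Field L] [Algebra K L]
    [Algebra A L] [IsScalarTower A K L] [FiniteDimensional K L] {θ : L} (hθ : IsIntegral A θ)
    [Field M] [Algebra A M] :
    ∃ (H : Type) (_ : Field H) (_ : Algebra M H), FiniteDimensional M H ∧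
      Module.finrank M H ≤ Module.finrank K L ∧
      ∃ f : Algebra.adjoin A {θ} →+* H,
        ∀ a : A, f (algebraMap A _ a) = algebraMap M H (algebraMap A M a) := by
  have : FaithfulSMul A L := by
    rw [faithfulSMul_iff_algebraMap_injective, IsScalarTower.algebraMap_eq A K L]
    exact (algebraMap K L).injective.comp (IsFractionRing.injective A K)
  have : Module.IsTorsionFree A L := by infer_instance
  have hmonic := minpoly.monic hθ
  set p := (minpoly A θ).map (algebraMap A M) with hp
  have hdeg : p.natDegree = (minpoly A θ).natDegree := hmonic.natDegree_map _
  have hp0 : p.natDegree ≠ 0 := by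
    rw [hdeg]; exact (minpoly.natDegree_pos hθ).ne'
  have hpne : p ≠ 0 := (hmonic.map _).ne_zero
  have : Fact (Irreducible p.factor) := ⟨irreducible_factor p⟩
  have hfne : p.factor ≠ 0 := (irreducible_factor p).ne_zero
  refine ⟨AdjoinRoot p.factor, inferInstance, inferInstance,
    (AdjoinRoot.powerBasis hfne).finite, ?_, ?_⟩
  · rw [(AdjoinRoot.powerBasis hfne).finrank, AdjoinRoot.powerBasis_dim]
    calc p.factor.natDegree ≤ p.natDegree :=
          natDegree_le_of_dvd (factor_dvd_of_natDegree_ne_zero hp0) hpne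
      _ = (minpoly K θ).natDegree := by
          rw [hdeg, minpoly.isIntegrallyClosed_eq_field_fractions' K hθ, hmonic.natDegree_map]
      _ ≤ _ := minpoly.natDegree_le θ
  · have hroot : aeval (AdjoinRoot.root p.factor)
        (minpoly A (Algebra.adjoin.powerBasis' hθ).gen) = 0 := by
      rw [← Algebra.adjoin.powerBasis'_minpoly_gen hθ, ← aeval_map_algebraMap M]
      obtain ⟨q, hq⟩ := factor_dvd_of_natDegree_ne_zero hp0
      rw [← hp, AdjoinRoot.aeval_eq, AdjoinRoot.mk_eq_zero]
      exact ⟨q, hq⟩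
    refine ⟨((Algebra.adjoin.powerBasis' hθ).lift _ hroot).toRingHom, fun a => ?_⟩
    exact (((Algebra.adjoin.powerBasis' hθ).lift _ hroot).commutes a).trans
      (IsScalarTower.algebraMap_apply A M _ a)

end Specialization

section LocalizedSpecialization

open Polynomial

variable {A K L : Type} [CommRing A] [IsDomain A] [Field K] [Algebra A K] [IsFractionRing A K]
  [Field L] [Algebra K L] [Algebra A L] [IsScalarTower A K L] [FiniteDimensional K L]

theorem exists_smul_mem_adjoin_of_adjoin_eq_top {θ : L} (hθ : K⟮θ⟯ = ⊤) (z : L) :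
    ∃ q : A, q ≠ 0 ∧ q • z ∈ Algebra.adjoin A {θ} := by
  have hz : z ∈ K⟮θ⟯ := hθ ▸ IntermediateField.mem_top
  rw [← IntermediateField.mem_toSubalgebra,
    IntermediateField.adjoin_simple_toSubalgebra_of_isAlgebraic (Algebra.IsAlgebraic.isAlgebraic θ),
    Algebra.adjoin_singleton_eq_range_aeval] at hz
  obtain ⟨p, rfl⟩ := hz
  obtain ⟨b, hb, hp⟩ := IsLocalization.integerNormalization_spec (nonZeroDivisors A) p
  refine ⟨b, nonZeroDivisors.ne_zero hb, ?_⟩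
  have : b • aeval θ p = aeval θ (IsLocalization.integerNormalization (nonZeroDivisors A) p) := by
    rw [← aeval_map_algebraMap K θ (IsLocalization.integerNormalization _ p), hp,
      ← IsScalarTower.algebraMap_smul K b p, map_smul,
      IsScalarTower.algebraMap_smul]
  change b • aeval θ p ∈ _
  rw [this]
  exact Polynomial.aeval_mem_adjoin_singleton A θ

theorem exists_smul_mem_adjoin_of_finset {θ : L} (hθ : K⟮θ⟯ = ⊤) (Z : Finset L) :
    ∃ q : A, q ≠ 0 ∧ ∀ z ∈ Z, q • z ∈ Algebra.adjoin A {θ} := by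
  classical
  choose q hq0 hq using exists_smul_mem_adjoin_of_adjoin_eq_top (A := A) hθ
  refine ⟨∏ z ∈ Z, q z, Finset.prod_ne_zero_iff.mpr fun z _ => hq0 z, fun z hz => ?_⟩
  rw [← Finset.prod_erase_mul _ _ hz, mul_smul]
  exact Subalgebra.smul_mem _ (hq z) _

theorem exists_isIntegral_adjoin_eq_top [CharZero K] : ∃ θ : L, IsIntegral A θ ∧ K⟮θ⟯ = ⊤ := by
  obtain ⟨θ, hθ⟩ := Field.exists_primitive_element K L
  have : Algebra.IsAlgebraic A L := IsFractionRing.comap_isAlgebraic_iff.mpr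
    (inferInstance : Algebra.IsAlgebraic K L)
  obtain ⟨y, hy0, hy⟩ := (Algebra.IsAlgebraic.isAlgebraic (R := A) θ).exists_integral_multiple
  refine ⟨y • θ, hy, ?_⟩
  rw [eq_top_iff, ← hθ, IntermediateField.adjoin_simple_le_iff]
  have h : θ = (algebraMap A K y)⁻¹ • (y • θ) := by
    rw [← IsScalarTower.algebraMap_smul K y θ, smul_smul, inv_mul_cancel₀, one_smul]
    exact (map_ne_zero_iff _ (IsFractionRing.injective A K)).mpr hy0
  have h2 : (algebraMap A K y)⁻¹ • (y • θ) ∈ K⟮y • θ⟯ :=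
    IntermediateField.smul_mem _ (IntermediateField.mem_adjoin_simple_self K _)
  rwa [← h] at h2

theorem exists_specialization_of_away {A K L : Type} [CommRing A] [IsDomain A] [Field K]
    [Algebra A K] [Field L] [Algebra K L] [Algebra A L] [FiniteDimensional K L]
    [IsIntegrallyClosed A] {Z : Finset L} {θ : L}
    (hθ : IsIntegral A θ) {q : A} (hq0 : q ≠ 0) (hq : ∀ z ∈ Z, q • z ∈ Algebra.adjoin A {θ})
    (B : Type) [CommRing B] [IsDomain B] [Algebra A B] [Algebra B K] [IsScalarTower A B K]
    [IsFractionRing B K]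
    [IsLocalization.Away q B] [Algebra B L] [IsScalarTower B K L] [IsScalarTower A B L]
    (M : Type) [Field M] (ψ : A →+* M) (hψ : ψ q ≠ 0) :
    ∃ (H : Type) (_ : Field H) (_ : Algebra M H), FiniteDimensional M H ∧
        Module.finrank M H ≤ Module.finrank K L ∧ ∃ R : Subalgebra A L, (Z : Set L) ⊆ R ∧
          ∃ f : R →+* H, ∀ a : A, f (algebraMap A R a) = algebraMap M H (ψ a) := by
  have : IsIntegrallyClosed B := isIntegrallyClosed_of_isLocalization B (Submonoid.powers q)
    (powers_le_nonZeroDivisors_of_noZeroDivisors hq0)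
  let := (IsLocalization.Away.lift (S := B) q (g := ψ) (IsUnit.mk0 _ hψ)).toAlgebra
  have hθ' : IsIntegral B θ := hθ.tower_top
  obtain ⟨H, _, _, h1, h2, f, hf⟩ := exists_adjoin_specialization (K := K) (M := M) hθ'
  let i : (Algebra.adjoin B {θ}).restrictScalars A →+* Algebra.adjoin B {θ} :=
    { toFun x := ⟨x.1, x.2⟩
      map_one' := rfl
      map_mul' _ _ := rfl
      map_zero' := rfl
      map_add' _ _ := rfl }
  refine ⟨H, _, _, h1, h2, (Algebra.adjoin B {θ}).restrictScalars A,
    fun z hz => ?_, f.comp i, fun a => ?_⟩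
  · have hle : Algebra.adjoin A {θ} ≤ (Algebra.adjoin B {θ}).restrictScalars A :=
      Algebra.adjoin_le fun y hy => (Algebra.subset_adjoin hy : y ∈ Algebra.adjoin B {θ})
    have h3 : q • z ∈ Algebra.adjoin B {θ} := (Subalgebra.mem_restrictScalars A).mp (hle (hq z hz))
    obtain ⟨u, hu⟩ := IsLocalization.Away.algebraMap_isUnit (S := B) q
    have h4 : (↑u⁻¹ : B) • (q • z) = z := by
      rw [← IsScalarTower.algebraMap_smul B q z, ← hu, smul_smul, Units.inv_mul, one_smul]
    have h5 := Subalgebra.smul_mem _ h3 (↑u⁻¹ : B)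
    rwa [h4] at h5
  · have h6 := hf (algebraMap A B a)
    have h7 := IsLocalization.Away.lift_eq (S := B) q (g := ψ) (IsUnit.mk0 _ hψ) a
    rw [← h7]
    refine Eq.trans (congrArg f ?_) h6
    exact Subtype.ext (IsScalarTower.algebraMap_apply A B L a)

theorem exists_specialization [IsIntegrallyClosed A] [CharZero K] (Z : Finset L) :
    ∃ q : A, q ≠ 0 ∧ ∀ (M : Type) [Field M] (ψ : A →+* M), ψ q ≠ 0 →
      ∃ (H : Type) (_ : Field H) (_ : Algebra M H), FiniteDimensional M H ∧
        Module.finrank M H ≤ Module.finrank K L ∧ ∃ R : Subalgebra A L, (Z : Set L) ⊆ R ∧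
          ∃ f : R →+* H, ∀ a : A, f (algebraMap A R a) = algebraMap M H (ψ a) := by
  obtain ⟨θ, hθ, htop⟩ := exists_isIntegral_adjoin_eq_top (A := A) (K := K) (L := L)
  obtain ⟨q, hq0, hq⟩ := exists_smul_mem_adjoin_of_finset (A := A) htop Z
  refine ⟨q, hq0, fun M _ ψ hψ => ?_⟩
  have hS : Submonoid.powers q ≤ nonZeroDivisors A :=
    powers_le_nonZeroDivisors_of_noZeroDivisors hq0
  have : IsLocalization.Away q (Localization.subalgebra.ofField K (Submonoid.powers q) hS) :=
    Localization.subalgebra.isLocalization_ofField ..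
  exact exists_specialization_of_away (K := K) hθ hq0 hq
    (Localization.subalgebra.ofField K (Submonoid.powers q) hS) M ψ hψ

end LocalizedSpecialization

section CurveSpecialization

open Polynomial

variable {k K L : Type} [Field k] [Field K] [Field L] [Algebra K L] [Algebra k L]

theorem exists_aeval_eq_zero_of_transcendental {A : Type} [CommRing A] [IsDomain A] [Algebra k A]
    [Algebra A K] [IsFractionRing A K] [Algebra A L] [IsScalarTower A K L] [FiniteDimensional K L]
    [IsScalarTower k A L] {y : L} (hy : Transcendental k y) :
    ∃ P : A[X], aeval y P = 0 ∧ ∀ c : k, P.eval (algebraMap k A c) ≠ 0 := by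
  refine ⟨IsLocalization.integerNormalization (nonZeroDivisors A) (minpoly K y),
    IsLocalization.integerNormalization_aeval_eq_zero _ _ (minpoly.aeval K y), fun c hc => hy ?_⟩
  obtain ⟨b, hb, hp⟩ := IsLocalization.integerNormalization_spec (nonZeroDivisors A) (minpoly K y)
  have h0 : (minpoly K y).IsRoot (algebraMap A K (algebraMap k A c)) := by
    have h1 := congrArg (algebraMap A K) hc
    rw [← Polynomial.eval_map_apply, hp, ← IsScalarTower.algebraMap_smul K b, eval_smul, map_zero,
      smul_eq_zero] at h1
    exact h1.resolve_left ((map_ne_zero_iff _ (IsFractionRing.injective A K)).mpr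
      (nonZeroDivisors.ne_zero hb))
  have h2 := minpoly.root (Algebra.IsIntegral.isIntegral y) h0
  rw [← IsScalarTower.algebraMap_apply A K L, ← IsScalarTower.algebraMap_apply k A L] at h2
  rw [← h2]
  exact isAlgebraic_algebraMap c

theorem MvPolynomial_totalDegree_eval_le {ι : Type} {N : ℕ} (P : (MvPolynomial ι k)[X])
    (hP : ∀ i, (P.coeff i).totalDegree ≤ N) (c : k) :
    (P.eval (algebraMap k (MvPolynomial ι k) c)).totalDegree ≤ N := by
  rw [eval_eq_sum_range]
  refine MvPolynomial.totalDegree_finsetSum_le fun i _ => ?_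
  rw [← map_pow, mul_comm, ← Algebra.smul_def]
  exact (MvPolynomial.totalDegree_smul_le _ _).trans (hP i)

variable {ι : Type} [Algebra (MvPolynomial ι k) K] [IsFractionRing (MvPolynomial ι k) K]
  [FiniteDimensional K L] [Algebra (MvPolynomial ι k) L] [IsScalarTower (MvPolynomial ι k) K L]
  [IsScalarTower k (MvPolynomial ι k) L]

theorem exists_curve_specialization [Finite ι] [IsAlgClosed k] [CharZero k] {y : L}
    (hy : Transcendental k y) (Z : Finset L) :
    ∃ (H : Type) (_ : Field H) (_ : Algebra k H) (_ : Algebra (RatFunc k) H),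
      IsScalarTower k (RatFunc k) H ∧
      FiniteDimensional (RatFunc k) H ∧ Module.finrank (RatFunc k) H ≤ Module.finrank K L ∧
      ∃ R : Subalgebra k L, (Z : Set L) ⊆ R ∧ ∃ (hyR : y ∈ R) (f : R →ₐ[k] H),
        Transcendental k (f ⟨y, hyR⟩) := by
  classical
  have : Fintype ι := Fintype.ofFinite ι
  have : CharZero K := charZero_of_injective_algebraMap
    (IsFractionRing.injective (MvPolynomial ι k) K)
  obtain ⟨q, hq0, hq⟩ := exists_specialization (A := MvPolynomial ι k) (K := K) (insert y Z)
  obtain ⟨P, hP0, hP⟩ := exists_aeval_eq_zero_of_transcendental (A := MvPolynomial ι k) (K := K) hy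
  let N := q.totalDegree + (P.support.sup fun i => (P.coeff i).totalDegree) + 1
  let ψ : MvPolynomial ι k →ₐ[k] k[X] :=
    MvPolynomial.aeval (fun i => (X : k[X]) ^ N ^ (Fintype.equivFin ι i : ℕ))
  have hψ : ∀ p : MvPolynomial ι k, p ≠ 0 → p.totalDegree < N → ψ p ≠ 0 := fun p hp hN =>
    mvPolynomial_aeval_X_pow_pow_ne_zero _ hp hN
  let Ψ : MvPolynomial ι k →+* RatFunc k := (algebraMap k[X] (RatFunc k)).comp ψ.toRingHom
  have hΨ : ∀ p, ψ p ≠ 0 → Ψ p ≠ 0 := fun p hp =>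
    (map_ne_zero_iff _ (IsFractionRing.injective k[X] (RatFunc k))).mpr hp
  obtain ⟨H, _, _, hfin, hrk, R, hR, f, hf⟩ := hq (RatFunc k) Ψ
    (hΨ _ (hψ q hq0 (by dsimp only [N]; omega)))
  let : Algebra k H := ((algebraMap (RatFunc k) H).comp (algebraMap k (RatFunc k))).toAlgebra
  have hyR : y ∈ R := hR (by simp)
  have hfk : ∀ c : k, f (algebraMap k (R.restrictScalars k) c) = algebraMap k H c := fun c => by
    have hc : algebraMap k (R.restrictScalars k) c =
        algebraMap (MvPolynomial ι k) R (algebraMap k _ c) :=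
      Subtype.ext (IsScalarTower.algebraMap_apply k (MvPolynomial ι k) L c)
    refine (congrArg f hc).trans ((hf (algebraMap k _ c)).trans ?_)
    change algebraMap _ H (algebraMap k[X] _ (ψ _)) = algebraMap _ H (algebraMap k (RatFunc k) c)
    rw [AlgHom.commutes, ← IsScalarTower.algebraMap_apply k k[X] (RatFunc k)]
  let f' : R.restrictScalars k →ₐ[k] H := { f with commutes' := hfk }
  refine ⟨H, inferInstance, inferInstance, inferInstance, 
    IsScalarTower.of_algebraMap_eq fun _ => rfl, hfin, hrk, R.restrictScalars k,
    fun z hz => hR (by simp [Finset.mem_coe.mp hz]), hyR, f', ?_⟩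
  refine transcendental_of_forall_algebraMap_ne fun c hc => ?_
  have h1 : eval₂ (algebraMap (MvPolynomial ι k) R) (⟨y, hyR⟩ : R) P = 0 := by
    apply Subtype.val_injective
    refine (hom_eval₂ P _ R.val.toRingHom _).trans hP0
  have h2 := congrArg f h1
  have h3 : f.comp (algebraMap (MvPolynomial ι k) R) = (algebraMap (RatFunc k) H).comp Ψ :=
    RingHom.ext hf
  have h4 : f ⟨y, hyR⟩ = ((algebraMap (RatFunc k) H).comp Ψ) (algebraMap k _ c) := by
    refine hc.symm.trans ((hfk c).symm.trans ?_)
    rw [← h3]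
    exact congrArg f (Subtype.ext (IsScalarTower.algebraMap_apply k (MvPolynomial ι k) L c))
  rw [hom_eval₂, h3, h4, eval₂_at_apply, map_zero, RingHom.comp_apply,
    map_eq_zero_iff _ (algebraMap (RatFunc k) H).injective] at h2
  refine hΨ _ (hψ _ (hP c) ?_) h2
  refine (MvPolynomial_totalDegree_eval_le (N := P.support.sup fun i => (P.coeff i).totalDegree)
    P (fun i => ?_) c).trans_lt (by dsimp only [N]; omega)
  by_cases hi : i ∈ P.support
  · exact Finset.le_sup (f := fun i => (P.coeff i).totalDegree) hi
  · simp [notMem_support_iff.mp hi]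

theorem injective_of_transcendental {F H : Type} [Field F] [Algebra k F] [Field H] [Algebra k H]
    (h1 : Algebra.trdeg k F ≤ 1) {x : F} (hx : Transcendental k x) {S : Subalgebra k F}
    (hxS : x ∈ S) (φ : S →ₐ[k] H) (hφ : Transcendental k (φ ⟨x, hxS⟩)) :
    Function.Injective φ := by
  rw [injective_iff_map_eq_zero]
  intro y hy
  by_contra hy0
  let := polynomialAlgebraAdjoinSimple (k := k) x
  let : Algebra k[X] F := (aeval x).toRingHom.toAlgebra
  let : Algebra k[X] S := (aeval (⟨x, hxS⟩ : S)).toRingHom.toAlgebra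
  have : IsScalarTower k[X] S F := IsScalarTower.of_algebraMap_eq fun p =>
    (Polynomial.aeval_algebraMap_apply F (⟨x, hxS⟩ : S) p)
  have : IsScalarTower k[X] k⟮x⟯ F := IsScalarTower.of_algebraMap_eq fun p =>
    (coe_polynomial_algebraMap_adjoin_simple x p).symm
  have := isFractionRing_polynomial_adjoin_simple hx
  have := isAlgebraic_adjoin_simple_of_trdeg_le_one h1 hx
  have halg : IsAlgebraic k[X] (y : F) :=
    (IsFractionRing.isAlgebraic_iff k[X] k⟮x⟯ F).mpr (Algebra.IsAlgebraic.isAlgebraic (y : F))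
  have halg' : IsAlgebraic k[X] y :=
    (isAlgebraic_algebraMap_iff (A := F) Subtype.val_injective).mp halg
  obtain ⟨r, hr0, z, hz⟩ := halg'.exists_nonzero_dvd (mem_nonZeroDivisors_of_ne_zero hy0)
  refine hφ ⟨r, hr0, ?_⟩
  have h2 := congrArg φ hz
  rw [map_mul, hy, zero_mul] at h2
  rw [← h2]
  exact Polynomial.aeval_algHom_apply φ _ r

theorem isAlgebraic_of_transcendental_algebraMap {F H : Type} [Field F] [Algebra k F] [Field H]
    [Algebra k H] [Algebra F H] [IsScalarTower k F H] (h1 : Algebra.trdeg k H ≤ 1) {x : F}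
    (hx : Transcendental k (algebraMap F H x)) : Algebra.IsAlgebraic F H := by
  let f := IsScalarTower.toAlgHom k F H
  have h : (k⟮x⟯).map f = k⟮algebraMap F H x⟯ := by
    rw [adjoin_map, Set.image_singleton]; rfl
  let e : k⟮x⟯ ≃ₐ[k] k⟮algebraMap F H x⟯ :=
    ((k⟮x⟯).equivMap f).trans (IntermediateField.equivOfEq h)
  have := isAlgebraic_adjoin_simple_of_trdeg_le_one h1 hx
  refine Algebra.IsAlgebraic.ringHom_of_comp_eq (R := k⟮algebraMap F H x⟯)
    ((algebraMap k⟮x⟯ F).comp e.symm.toRingEquiv.toRingHom) (RingHom.id H)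
    ((algebraMap k⟮x⟯ F).injective.comp e.symm.injective) Function.surjective_id ?_
  ext y
  obtain ⟨z, rfl⟩ := e.surjective y
  simp only [RingHom.comp_apply]
  change algebraMap F H (algebraMap _ F (e.symm (e z))) = _
  rw [AlgEquiv.symm_apply_apply]
  rfl

/-- A function field of transcendence degree one embedded in a degree `d` extension of a rational
function field has gonality at most `d`. -/
theorem exists_finrank_adjoin_le_of_algHom [Finite ι] [IsAlgClosed k] [CharZero k]
    {F : Type} [Field F] [Algebra k F] [Algebra.EssFiniteType k F] (h1 : Algebra.trdeg k F ≤ 1)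
    {x : F} (hx : Transcendental k x) (j : F →ₐ[k] L) :
    ∃ h : F, Transcendental k h ∧ Module.finrank k⟮h⟯ F ≤ Module.finrank K L := by
  classical
  obtain ⟨s, hs⟩ := IntermediateField.fg_top_iff.mpr (inferInstance : Algebra.EssFiniteType k F)
  have hjx : Transcendental k (j x) := fun h => hx ((isAlgebraic_algHom_iff j j.injective).mp h)
  obtain ⟨H, _, _, _, _, hfin, hrk, R, hZR, hyR, f, hf⟩ :=
    exists_curve_specialization (K := K) (ι := ι) hjx (insert (j x) (s.image j))
  let S : Subalgebra k F := Algebra.adjoin k (insert x s)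
  have hxS : x ∈ S := Algebra.subset_adjoin (Set.mem_insert _ _)
  have hSR : S ≤ R.comap j := Algebra.adjoin_le (by
    intro z hz
    apply hZR
    rcases hz with rfl | hz
    · simp
    · simp only [Finset.coe_insert, Finset.coe_image]
      exact Or.inr ⟨z, hz, rfl⟩)
  let φ : S →ₐ[k] H := f.comp ((j.comp S.val).codRestrict R fun z => hSR z.2)
  have hφx : Transcendental k (φ ⟨x, hxS⟩) := hf
  have hφ : Function.Injective φ := injective_of_transcendental h1 hx hxS φ hφx
  have htop : adjoin k (insert x s : Set F) = ⊤ :=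
    eq_top_iff.mpr (hs ▸ adjoin.mono k _ _ (Set.subset_insert _ _))
  have : IsFractionRing S F := IsFractionRing.of_field S F fun z => by
    obtain ⟨a, ha, b, hb, he⟩ := mem_adjoin_iff_div.mp
      (htop ▸ mem_top : z ∈ adjoin k (insert x s : Set F))
    exact ⟨⟨a, ha⟩, ⟨b, hb⟩, he⟩
  let Φ : F →ₐ[k] H := IsFractionRing.liftAlgHom hφ
  let : Algebra F H := Φ.toRingHom.toAlgebra
  have : IsScalarTower k F H := IsScalarTower.of_algebraMap_eq fun c => (Φ.commutes c).symm
  have hX : (k⟮(RatFunc.X : RatFunc k)⟯) = ⊤ := RatFunc.adjoin_X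
  have hXt : Algebra.trdeg k (RatFunc k) ≤ 1 := by
    have : Algebra.IsAlgebraic k⟮(RatFunc.X : RatFunc k)⟯ (RatFunc k) := by
      rw [hX]; infer_instance
    exact trdeg_le_one_of_isAlgebraic_adjoin_simple (x := (RatFunc.X : RatFunc k))
  have hH1 : Algebra.trdeg k H ≤ 1 := trdeg_le_one_of_isAlgebraic (E := RatFunc k) hXt
  have hXtr : Transcendental k (RatFunc.X : RatFunc k) := RatFunc.transcendental_X
  have hess : Algebra.EssFiniteType k H := by
    have : Algebra.EssFiniteType k (RatFunc k) :=
      IntermediateField.fg_top_iff.mp ⟨{RatFunc.X}, by simpa using hX⟩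
    exact Algebra.EssFiniteType.comp k (RatFunc k) H
  have hxH : Transcendental k (algebraMap F H x) :=
    (transcendental_algebraMap_iff (algebraMap F H).injective).mpr hx
  have : FiniteDimensional F H := by
    have : Algebra.EssFiniteType F H := Algebra.EssFiniteType.of_comp k F H
    have := isAlgebraic_of_transcendental_algebraMap hH1 hxH
    exact Algebra.finite_of_essFiniteType_of_isAlgebraic
  obtain ⟨h, hh, hle⟩ := exists_finrank_adjoin_le (F := F) hH1
    (transcendental_algebraMap_iff (algebraMap (RatFunc k) H).injective |>.mpr hXtr)
  refine ⟨h, hh, hle.trans ?_⟩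
  rw [finrank_adjoin_algebraMap, hX, IntermediateField.finrank_top, one_mul]
  exact hrk

end CurveSpecialization

section Hyperelliptic

open Polynomial

theorem exists_sq_mul_prod_X_sub_C {k : Type} [Field k] (m : Multiset k) :
    ∃ (Q : k[X]) (s : Finset k), Q ≠ 0 ∧
      (m.map fun a => X - C a).prod = Q ^ 2 * ∏ r ∈ s, (X - C r) := by
  classical
  induction m using Multiset.induction_on with
  | empty => exact ⟨1, ∅, one_ne_zero, by simp⟩
  | cons a m ih =>
    obtain ⟨Q, s, hQ, h⟩ := ih
    by_cases ha : a ∈ s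
    · refine ⟨Q * (X - C a), s.erase a, mul_ne_zero hQ (X_sub_C_ne_zero a), ?_⟩
      rw [Multiset.map_cons, Multiset.prod_cons, h, ← Finset.mul_prod_erase s _ ha]
      ring
    · refine ⟨Q, insert a s, hQ, ?_⟩
      rw [Multiset.map_cons, Multiset.prod_cons, h, Finset.prod_insert ha]
      ring

theorem exists_eq_sq_mul_prod_X_sub_C {k : Type} [Field k] [IsAlgClosed k] {P : k[X]}
    (hP : P ≠ 0) : ∃ (Q : k[X]) (s : Finset k), Q ≠ 0 ∧ P = Q ^ 2 * ∏ r ∈ s, (X - C r) := by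
  obtain ⟨Q, s, hQ, h⟩ := exists_sq_mul_prod_X_sub_C P.roots
  obtain ⟨c, hc⟩ := IsAlgClosed.exists_pow_nat_eq P.leadingCoeff two_pos
  have hc0 : c ≠ 0 := by
    rintro rfl
    rw [zero_pow two_ne_zero] at hc
    exact hP (leadingCoeff_eq_zero.mp hc.symm)
  refine ⟨C c * Q, s, mul_ne_zero (C_ne_zero.mpr hc0) hQ, ?_⟩
  have h2 := (IsAlgClosed.splits P).eq_prod_roots
  rw [h, ← hc] at h2
  rw [mul_pow, mul_assoc, ← C_pow]
  exact h2

theorem exists_sq_mem_of_finrank_eq_two {k F : Type} [Field k] [Field F] [CharZero k] [Algebra k F]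
    (h2 : Module.finrank k F = 2) :
    ∃ (w : F) (c : k), w ∉ (⊥ : IntermediateField k F) ∧ w ^ 2 = algebraMap k F c := by
  have : FiniteDimensional k F := FiniteDimensional.of_finrank_pos (by omega)
  obtain ⟨y, hy⟩ : ∃ y : F, y ∉ (⊥ : IntermediateField k F) := by
    by_contra! h
    have : (⊥ : IntermediateField k F) = ⊤ := eq_top_iff.mpr fun y _ => h y
    rw [← IntermediateField.finrank_top', ← this, IntermediateField.finrank_bot] at h2
    omega
  have hint : IsIntegral k y := Algebra.IsIntegral.isIntegral y
  have htop : k⟮y⟯ = ⊤ := by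
    have : IsSimpleOrder (IntermediateField k F) :=
      IntermediateField.isSimpleOrder_of_finrank_prime k F (by rw [h2]; exact Nat.prime_two)
    refine (IsSimpleOrder.eq_bot_or_eq_top _).resolve_left fun h => hy ?_
    rw [← h]
    exact IntermediateField.mem_adjoin_simple_self k y
  have hdeg : (minpoly k y).natDegree = 2 := by
    rw [← IntermediateField.adjoin.finrank hint, htop, IntermediateField.finrank_top', h2]
  have hq := minpoly.aeval k y
  rw [aeval_eq_sum_range, hdeg] at hq
  simp only [Finset.sum_range_succ, Finset.sum_range_zero, Algebra.smul_def] at hq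
  have hl : (minpoly k y).coeff 2 = 1 := by
    rw [← hdeg]; exact minpoly.monic hint
  set a := (minpoly k y).coeff 0
  set b := (minpoly k y).coeff 1
  rw [hl] at hq
  refine ⟨y + algebraMap k F (b / 2), (b / 2) ^ 2 - a, fun h => hy ?_, ?_⟩
  · have h3 := sub_mem h ((⊥ : IntermediateField k F).algebraMap_mem (b / 2))
    rwa [add_sub_cancel_right] at h3
  · have : (2 : F) ≠ 0 := by
      have : CharZero F := charZero_of_injective_algebraMap (algebraMap k F).injective
      exact two_ne_zero
    simp only [map_sub, map_pow, map_div₀, map_ofNat, map_one] at hq ⊢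
    field_simp
    linear_combination 4 * hq

theorem eq_top_of_mem_of_finrank_eq_two {k F : Type} [Field k] [Field F] [Algebra k F] {h w : F}
    (h2 : Module.finrank k⟮h⟯ F = 2) (hw : w ∉ k⟮h⟯) {S : IntermediateField k F} (hhS : h ∈ S)
    (hwS : w ∈ S) : S = ⊤ := by
  have : FiniteDimensional k⟮h⟯ F := FiniteDimensional.of_finrank_pos (by omega)
  have : IsSimpleOrder (IntermediateField k⟮h⟯ F) :=
    IntermediateField.isSimpleOrder_of_finrank_prime k⟮h⟯ F (by rw [h2]; exact Nat.prime_two)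
  have hle : k⟮h⟯ ≤ S := IntermediateField.adjoin_simple_le_iff.mpr hhS
  obtain hb | ht := IsSimpleOrder.eq_bot_or_eq_top (IntermediateField.extendScalars hle)
  · have : w ∈ IntermediateField.extendScalars hle := hwS
    rw [hb, IntermediateField.mem_bot] at this
    obtain ⟨z, rfl⟩ := this
    exact absurd z.2 hw
  · rw [eq_top_iff]
    intro y _
    have : y ∈ IntermediateField.extendScalars hle := ht ▸ IntermediateField.mem_top
    exact this

/-- Every function field with a rational function of degree at most two is rational or is given by
an equation `w ^ 2 = ∏ (h - r)` with at least three distinct roots `r`. -/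
theorem exists_hyperelliptic {k F : Type} [Field k] [Field F] [Algebra k F] [IsAlgClosed k]
    [CharZero k] {h : F} (hh : Transcendental k h) [FiniteDimensional k⟮h⟯ F]
    (h2 : Module.finrank k⟮h⟯ F ≤ 2) :
    (∃ t : F, Transcendental k t ∧ k⟮t⟯ = ⊤) ∨
      ∃ (w : F) (s : Finset k), 3 ≤ s.card ∧ w ^ 2 = ∏ r ∈ s, (h - algebraMap k F r) := by
  classical
  have hpos : 0 < Module.finrank k⟮h⟯ F := Module.finrank_pos
  obtain h1 | h2 : Module.finrank k⟮h⟯ F = 1 ∨ Module.finrank k⟮h⟯ F = 2 := by omega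
  · exact Or.inl ⟨h, hh, by rwa [IntermediateField.finrank_eq_one_iff_eq_top] at h1⟩
  obtain ⟨w, c, hw, hwc⟩ := exists_sq_mem_of_finrank_eq_two h2
  have hw' : w ∉ k⟮h⟯ := fun hm => hw (IntermediateField.mem_bot.mpr ⟨⟨w, hm⟩, rfl⟩)
  have haev : ∀ p : k[X], p ≠ 0 → aeval h p ≠ 0 := fun p hp h0 => hh ⟨p, hp, h0⟩
  have haevmem : ∀ p : k[X], aeval h p ∈ k⟮h⟯ := fun p =>
    IntermediateField.algebra_adjoin_le_adjoin k _ (Polynomial.aeval_mem_adjoin_singleton k h)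
  obtain ⟨p, q, hpq⟩ := (mem_adjoin_simple_iff k (c : F)).mp c.2
  have hw0 : w ≠ 0 := fun h0 => hw' (h0 ▸ zero_mem _)
  have hwc' : w ^ 2 = aeval h p / aeval h q := hwc.trans hpq
  have hne := pow_ne_zero 2 hw0
  rw [hwc'] at hne
  obtain ⟨hp0, hq0⟩ := div_ne_zero_iff.mp hne
  have hP : p * q ≠ 0 := by
    rintro h0
    have := congrArg (aeval h) h0
    rw [map_mul, map_zero] at this
    exact mul_ne_zero hp0 hq0 this
  obtain ⟨Q, s, hQ, hPQ⟩ := exists_eq_sq_mul_prod_X_sub_C hP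
  have hQ0 := haev Q hQ
  have hv : (w * aeval h q / aeval h Q) ^ 2 = ∏ r ∈ s, (h - algebraMap k F r) := by
    have h3 := congrArg (aeval h) hPQ
    simp only [map_mul, map_pow, map_prod, map_sub, aeval_X, aeval_C] at h3
    rw [div_pow, mul_pow, hwc']
    field_simp
    exact h3
  have hvmem : w * aeval h q / aeval h Q ∉ k⟮h⟯ := by
    intro hm
    apply hw'
    have := mul_mem hm (div_mem (haevmem Q) (haevmem q))
    rwa [div_mul_div_cancel₀ hQ0, mul_div_cancel_right₀ _ hq0] at this
  set v := w * aeval h q / aeval h Q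
  have htop : ∀ S : IntermediateField k F, h ∈ S → v ∈ S → S = ⊤ := fun S =>
    eq_top_of_mem_of_finrank_eq_two h2 hvmem
  have htr : ∀ t : F, k⟮t⟯ = ⊤ → Transcendental k t := by
    intro t ht
    refine transcendental_of_forall_algebraMap_ne fun a ha => ?_
    have hmem : h ∈ k⟮t⟯ := ht ▸ IntermediateField.mem_top
    rw [← ha, IntermediateField.adjoin_simple_eq_bot_iff.mpr
      ((⊥ : IntermediateField k F).algebraMap_mem a), IntermediateField.mem_bot] at hmem
    obtain ⟨b, rfl⟩ := hmem
    exact hh (isAlgebraic_algebraMap b)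
  by_cases hs : 3 ≤ s.card
  · exact Or.inr ⟨v, s, hs, hv⟩
  left
  suffices ∃ t : F, k⟮t⟯ = ⊤ from this.imp fun t ht => ⟨htr t ht, ht⟩
  have hcard : s.card = 0 ∨ s.card = 1 ∨ s.card = 2 := by omega
  have hmemk : ∀ (S : IntermediateField k F) (a : k), algebraMap k F a ∈ S := fun S a =>
    S.algebraMap_mem a
  rcases hcard with h0 | h0 | h0
  · rw [Finset.card_eq_zero.mp h0, Finset.prod_empty, sq_eq_one_iff] at hv
    rcases hv with hv | hv
    · exact absurd (hv ▸ one_mem _) hvmem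
    · exact absurd (hv ▸ neg_mem (one_mem _)) hvmem
  · obtain ⟨a, rfl⟩ := Finset.card_eq_one.mp h0
    rw [Finset.prod_singleton] at hv
    refine ⟨v, htop _ ?_ (IntermediateField.mem_adjoin_simple_self k v)⟩
    have : h = v ^ 2 + algebraMap k F a := by rw [hv]; ring
    rw [this]
    exact add_mem (pow_mem (IntermediateField.mem_adjoin_simple_self k v) 2) (hmemk _ _)
  · obtain ⟨a, b, hab, rfl⟩ := Finset.card_eq_two.mp h0
    rw [Finset.prod_pair hab] at hv
    have hha : h - algebraMap k F a ≠ 0 := fun he => hh (by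
      rw [sub_eq_zero.mp he]; exact isAlgebraic_algebraMap a)
    have hab' : algebraMap k F a - algebraMap k F b ≠ 0 := fun he =>
      hab ((algebraMap k F).injective (sub_eq_zero.mp he))
    set t := v / (h - algebraMap k F a) with ht
    have htm := IntermediateField.mem_adjoin_simple_self k t
    have ht2 : t ^ 2 * (h - algebraMap k F a) = h - algebraMap k F b := by
      rw [ht, div_pow, hv]; field_simp
    have hhm : h ∈ k⟮t⟯ := by
      have hne : t ^ 2 - 1 ≠ 0 := fun he => hab' (by
        linear_combination (h - algebraMap k F a) * he - ht2)
      have : h = (t ^ 2 * algebraMap k F a - algebraMap k F b) / (t ^ 2 - 1) := by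
        rw [eq_div_iff hne]; linear_combination ht2
      rw [this]
      exact div_mem (sub_mem (mul_mem (pow_mem htm 2) (hmemk _ _)) (hmemk _ _))
        (sub_mem (pow_mem htm 2) (one_mem _))
    refine ⟨t, htop _ hhm ?_⟩
    have : v = t * (h - algebraMap k F a) := by rw [ht, div_mul_cancel₀ _ hha]
    rw [this]
    exact mul_mem htm (sub_mem hhm (hmemk _ _))

end Hyperelliptic

section TraceLemma

open Polynomial

theorem separable_X_pow_mul_prod {C : Type} [Field C] (s : Finset C) (c : C) {e : ℕ} (he : e ≤ 1) :
    ((X : C[X]) ^ e * ∏ r ∈ s, (1 + Polynomial.C (c - r) * X)).Separable := by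
  have hprod : (∏ r ∈ s, (1 + Polynomial.C (c - r) * X) : C[X]).Separable := by
    refine separable_prod' (fun x _ y _ hxy => ?_) fun x _ => ?_
    · have hne : x - y ≠ 0 := sub_ne_zero.mpr hxy
      refine ⟨Polynomial.C ((c - y) / (x - y)), Polynomial.C (-(c - x) / (x - y)), ?_⟩
      have h1 : (c - y) / (x - y) + -(c - x) / (x - y) = 1 := by field_simp; ring
      have h2 : (c - y) / (x - y) * (c - x) + -(c - x) / (x - y) * (c - y) = 0 := by
        field_simp; ring
      have h3 := congrArg Polynomial.C h1
      have h4 := congrArg Polynomial.C h2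
      simp only [map_add, map_mul, map_one, map_zero] at h3 h4
      linear_combination h3 + X * h4
    · refine ⟨1, -X, ?_⟩
      simp only [derivative_add, derivative_one, derivative_C_mul, derivative_X]
      ring
  obtain rfl | rfl : e = 0 ∨ e = 1 := by omega
  · simpa using hprod
  · rw [pow_one]
    refine separable_X.mul hprod ?_
    refine IsCoprime.prod_right fun r _ => ⟨-Polynomial.C (c - r), 1, by ring⟩

variable {C L : Type} [Field C] [Field L] [Algebra C L] (σ : L ≃ₐ[C] L)
  (R : Subalgebra C L)

/-- The data of a derivation-stable valuation ring inside the fixed field of the involution `σ`. -/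
structure IsInvariantValuationRing (D : Derivation C L L) : Prop where
  involutive : ∀ x, σ (σ x) = x
  fixed : ∀ x ∈ R, σ x = x
  mem_or_inv_mem : ∀ x, σ x = x → x ∈ R ∨ x⁻¹ ∈ R
  comm : ∀ x, D (σ x) = σ (D x)
  deriv_mem : ∀ x ∈ R, D x ∈ R

namespace IsInvariantValuationRing

variable {σ R} {D : Derivation C L L}

theorem mem_of_sq_mem (H : IsInvariantValuationRing σ R D)
    {y : L} (hy : σ y = y) (h : y ^ 2 ∈ R) : y ∈ R := by
  rcases H.mem_or_inv_mem y hy with h1 | h1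
  · exact h1
  · by_cases h0 : y = 0
    · rw [h0]; exact zero_mem R
    · have := mul_mem h h1
      rwa [pow_two, mul_assoc, mul_inv_cancel₀ h0, mul_one] at this

theorem mul_mem_of_anti (H : IsInvariantValuationRing σ R D)
    {u v : L} (hu : σ u = -u) (hv : σ v = -v) (hu2 : u ^ 2 ∈ R)
    (hv2 : v ^ 2 ∈ R) : u * v ∈ R := by
  refine H.mem_of_sq_mem (by rw [map_mul, hu, hv]; ring) ?_
  rw [mul_pow]
  exact mul_mem hu2 hv2

theorem exists_dvd_of_three (H : IsInvariantValuationRing σ R D)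
    {a b c : L} (ha : σ a = a) (hb : σ b = b) (hc : σ c = c)
    (ha0 : a ≠ 0) (hb0 : b ≠ 0) (hc0 : c ≠ 0) :
    ∃ d : L, (d = a ∨ d = b ∨ d = c) ∧ a / d ∈ R ∧ b / d ∈ R ∧ c / d ∈ R := by
  have tot : ∀ x y : L, σ x = x → σ y = y → x / y ∈ R ∨ y / x ∈ R := fun x y hx hy => by
    have := H.mem_or_inv_mem (x / y) (by rw [map_div₀, hx, hy])
    rwa [inv_div] at this
  have tr : ∀ x y z : L, y ≠ 0 → x / y ∈ R → y / z ∈ R → x / z ∈ R := fun x y z hy h1 h2 => by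
    have := mul_mem h1 h2
    rwa [div_mul_div_cancel₀ hy] at this
  have self : ∀ x : L, x ≠ 0 → x / x ∈ R := fun x hx => by rw [div_self hx]; exact one_mem R
  rcases tot a b ha hb with h | h
  · rcases tot b c hb hc with h' | h'
    · exact ⟨c, by simp, tr a b c hb0 h h', h', self c hc0⟩
    · exact ⟨b, by simp, h, self b hb0, h'⟩
  · rcases tot a c ha hc with h' | h'
    · exact ⟨c, by simp, h', tr b a c ha0 h h', self c hc0⟩
    · exact ⟨a, by simp, self a ha0, h, h'⟩

variable [CharZero C]

theorem half_mem {x : L} (h : 2 * x ∈ R) : x ∈ R := by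
  have := R.smul_mem h (2⁻¹ : C)
  rwa [Algebra.smul_def, ← mul_assoc, map_inv₀, map_ofNat, inv_mul_cancel₀ ?_, one_mul] at this
  have : CharZero L := charZero_of_injective_algebraMap (algebraMap C L).injective
  exact two_ne_zero

theorem mul_deriv_mem_of_anti (H : IsInvariantValuationRing σ R D)
    {u v : L} (hu : σ u = -u) (hv : σ v = -v) (hu2 : u ^ 2 ∈ R)
    (hv2 : v ^ 2 ∈ R) : u * D v ∈ R := by
  have key : ∀ x : L, x ^ 2 ∈ R → x * D x ∈ R := fun x hx => by
    refine half_mem ?_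
    have := H.deriv_mem _ hx
    rw [pow_two, D.leibniz, smul_eq_mul] at this
    convert this using 1
    ring
  by_cases hu0 : u = 0
  · rw [hu0, zero_mul]; exact zero_mem R
  by_cases hv0 : v = 0
  · rw [hv0, map_zero, mul_zero]; exact zero_mem R
  rcases H.mem_or_inv_mem (u / v) (by rw [map_div₀, hu, hv, neg_div_neg_eq]) with h | h
  · have := mul_mem h (key v hv2)
    convert this using 1
    field_simp
  · rw [inv_div] at h
    have h1 : v = v / u * u := by field_simp
    have h2 : D v = v / u * D u + u * D (v / u) := by
      conv_lhs => rw [h1, D.leibniz, smul_eq_mul, smul_eq_mul]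
    have := add_mem (mul_mem h (key u hu2)) (mul_mem hu2 (H.deriv_mem _ h))
    convert this using 1
    rw [h2]; ring

/-- The integral closure of `R` in `L`, described through the decomposition of an element into its
invariant and anti-invariant parts. -/
def integers (H : IsInvariantValuationRing σ R D) : Subalgebra C L where
  carrier := {b | ∃ e v, b = e + v ∧ e ∈ R ∧ σ v = -v ∧ v ^ 2 ∈ R}
  algebraMap_mem' c := ⟨algebraMap C L c, 0, by simp, R.algebraMap_mem c, by simp, by simp⟩
  add_mem' := by
    rintro _ _ ⟨e, u, rfl, he, hu, hu2⟩ ⟨e', v, rfl, he', hv, hv2⟩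
    refine ⟨e + e', u + v, by ring, add_mem he he', by rw [map_add, hu, hv]; ring, ?_⟩
    have h := H.mul_mem_of_anti hu hv hu2 hv2
    have := add_mem (add_mem hu2 hv2) (add_mem h h)
    convert this using 1
    ring
  mul_mem' := by
    rintro _ _ ⟨e, u, rfl, he, hu, hu2⟩ ⟨e', v, rfl, he', hv, hv2⟩
    have h := H.mul_mem_of_anti hu hv hu2 hv2
    refine ⟨e * e' + u * v, e * v + e' * u, by ring, add_mem (mul_mem he he') h, ?_, ?_⟩
    · rw [map_add, map_mul, map_mul, hu, hv, H.fixed e he, H.fixed e' he']; ring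
    · have h1 := mul_mem (mul_mem he he') h
      have := add_mem (add_mem (mul_mem (pow_mem he 2) hv2) (mul_mem (pow_mem he' 2) hu2))
        (add_mem h1 h1)
      convert this using 1
      ring

theorem mem_integers_iff (H : IsInvariantValuationRing σ R D)
    {b : L} : b ∈ H.integers ↔ b + σ b ∈ R ∧ b * σ b ∈ R := by
  have : CharZero L := charZero_of_injective_algebraMap (algebraMap C L).injective
  constructor
  · rintro ⟨e, v, rfl, he, hv, hv2⟩
    rw [map_add, hv, H.fixed e he]
    refine ⟨?_, ?_⟩
    · convert add_mem he he using 1; ring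
    · convert sub_mem (pow_mem he 2) hv2 using 1; ring
  · rintro ⟨h1, h2⟩
    have he : (b + σ b) / 2 ∈ R := half_mem (by convert h1 using 1; field_simp)
    refine ⟨(b + σ b) / 2, (b - σ b) / 2, by ring, he, ?_, ?_⟩
    · rw [map_div₀, map_sub, H.involutive, map_ofNat]; ring
    · convert sub_mem (pow_mem he 2) h2 using 1; ring

theorem mem_integers_of_sq_mem (H : IsInvariantValuationRing σ R D)
    {w : L} (h : w ^ 2 ∈ H.integers) : w ∈ H.integers := by
  rw [mem_integers_iff, map_pow] at h
  obtain ⟨h1, h2⟩ := h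
  have hn : w * σ w ∈ R := by
    refine H.mem_of_sq_mem (by rw [map_mul, H.involutive]; ring) ?_
    convert h2 using 1; ring
  refine H.mem_integers_iff.mpr ⟨?_, hn⟩
  refine H.mem_of_sq_mem (by rw [map_add, H.involutive]; ring) ?_
  convert add_mem h1 (add_mem hn hn) using 1; ring

theorem trace_mul_deriv_mem (H : IsInvariantValuationRing σ R D)
    {b c : L} (hb : b ∈ H.integers) (hc : c ∈ H.integers) :
    b * D c + σ (b * D c) ∈ R := by
  obtain ⟨e, u, rfl, he, hu, hu2⟩ := hb
  obtain ⟨e', v, rfl, he', hv, hv2⟩ := hc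
  have h : e * D e' + u * D v ∈ R :=
    add_mem (mul_mem he (H.deriv_mem _ he')) (H.mul_deriv_mem_of_anti hu hv hu2 hv2)
  convert add_mem h h using 1
  have hDv : σ (D v) = -D v := by rw [← H.comm, hv, map_neg]
  have hDe : σ (D e') = D e' := by rw [← H.comm, H.fixed e' he']
  simp only [map_mul, map_add, hu, hDv, hDe, H.fixed e he]
  ring

theorem exists_inv_sub_mem_integers (H : IsInvariantValuationRing σ R D)
    {h : L} (hh : ∀ c : C, h ≠ algebraMap C L c) :
    ∃ c : C, (h - algebraMap C L c)⁻¹ ∈ H.integers := by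
  have : CharZero L := charZero_of_injective_algebraMap (algebraMap C L).injective
  have h0 : ∀ c : C, h - algebraMap C L c ≠ 0 := fun c => sub_ne_zero.mpr (hh c)
  have hσ : ∀ c : C, σ h - algebraMap C L c ≠ 0 := fun c hc => h0 c <| σ.injective <| by
    rw [map_sub, AlgEquiv.commutes, hc, map_zero]
  have hp : ∀ c : C, σ ((h - algebraMap C L c) * (σ h - algebraMap C L c)) =
      (h - algebraMap C L c) * (σ h - algebraMap C L c) := fun c => by
    simp only [map_mul, map_sub, AlgEquiv.commutes, H.involutive]; ring
  have hp0 : ∀ c : C, (h - algebraMap C L c) * (σ h - algebraMap C L c) ≠ 0 := fun c =>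
    mul_ne_zero (h0 c) (hσ c)
  obtain ⟨d, hd, ha, hb, hc⟩ := H.exists_dvd_of_three (hp 0) (hp 1) (hp (-1)) (hp0 0) (hp0 1)
    (hp0 (-1))
  have hd' : ∃ c : C, d = (h - algebraMap C L c) * (σ h - algebraMap C L c) := by
    rcases hd with hd | hd | hd
    exacts [⟨0, hd⟩, ⟨1, hd⟩, ⟨-1, hd⟩]
  obtain ⟨c, hdc⟩ := hd'
  have hd0 : d ≠ 0 := hdc ▸ hp0 c
  simp only [map_zero, map_one, map_neg, sub_zero, sub_neg_eq_add] at ha hb hc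
  have h1 : 1 / d ∈ R := by
    refine half_mem ?_
    convert sub_mem (add_mem hb hc) (add_mem ha ha) using 1
    field_simp
    ring
  have h2 : (h + σ h) / d ∈ R := by
    refine half_mem ?_
    convert sub_mem hc hb using 1
    field_simp
    ring
  refine ⟨c, H.mem_integers_iff.mpr ⟨?_, ?_⟩⟩
  · have h3 := sub_mem h2 (mul_mem (R.algebraMap_mem (2 * c)) h1)
    convert h3 using 1
    have := h0 c
    have := hσ c
    rw [map_inv₀, map_sub, AlgEquiv.commutes, hdc, map_mul, map_ofNat]
    field_simp
    ring
  · convert h1 using 1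
    rw [map_inv₀, map_sub, AlgEquiv.commutes, hdc, ← mul_inv, one_div]

theorem trace_deriv_div_mem (H : IsInvariantValuationRing σ R D)
    {h w : L} (hh : ∀ c : C, h ≠ algebraMap C L c) {s : Finset C}
    (hs : 3 ≤ s.card) (hw : w ^ 2 = ∏ r ∈ s, (h - algebraMap C L r)) :
    D h / w + σ (D h / w) ∈ R := by
  have : CharZero L := charZero_of_injective_algebraMap (algebraMap C L).injective
  obtain ⟨c, hk⟩ := H.exists_inv_sub_mem_integers hh
  set k := (h - algebraMap C L c)⁻¹ with hkdef
  have h0 : h - algebraMap C L c ≠ 0 := sub_ne_zero.mpr (hh c)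
  have hk0 : k ≠ 0 := inv_ne_zero h0
  have hw0 : w ≠ 0 := by
    rintro rfl
    rw [zero_pow two_ne_zero, eq_comm, Finset.prod_eq_zero_iff] at hw
    obtain ⟨r, -, hr⟩ := hw
    exact hh r (sub_eq_zero.mp hr)
  obtain ⟨m, e, hm, he, hmn⟩ : ∃ m e : ℕ, 2 ≤ m ∧ e ≤ 1 ∧ 2 * m = e + s.card :=
    ⟨(s.card + 1) / 2, s.card % 2, by omega, by omega, by omega⟩
  set P : C[X] := X ^ e * ∏ r ∈ s, (1 + Polynomial.C (c - r) * X) with hP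
  obtain ⟨α, β, hαβ⟩ := separable_X_pow_mul_prod s c he
  have hW : (w * k ^ m) ^ 2 = aeval k P := by
    have h1 : ∀ r ∈ s, (h - algebraMap C L r) * k = 1 + algebraMap C L (c - r) * k :=
      fun r _ => by
        rw [hkdef, map_sub]; field_simp; ring
    rw [mul_pow, hw, ← pow_mul, mul_comm m 2, hmn, pow_add, hP, map_mul, map_pow, aeval_X,
      map_prod]
    simp only [map_add, map_mul, map_one, aeval_X, aeval_C]
    rw [← Finset.prod_congr rfl h1, Finset.prod_mul_distrib, Finset.prod_const]
    ring
  have hmem : ∀ q : C[X], aeval k q ∈ H.integers := fun q => by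
    have := aeval_mem_adjoin_singleton (R := C) (p := q) k
    exact Algebra.adjoin_le (by simpa using hk) this
  have hWmem : w * k ^ m ∈ H.integers := H.mem_integers_of_sq_mem (hW ▸ hmem P)
  set W := w * k ^ m with hWdef
  have hW0 : W ≠ 0 := mul_ne_zero hw0 (pow_ne_zero _ hk0)
  have hDW : 2 * W * D W = aeval k (derivative P) * D k := by
    have h1 := congrArg D hW
    rw [pow_two, D.leibniz, D.map_aeval, smul_eq_mul, smul_eq_mul] at h1
    linear_combination h1
  have hDh : D k = - k ^ 2 * D h := by
    rw [hkdef, D.leibniz_inv, map_sub, D.map_algebraMap, sub_zero, smul_eq_mul]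
  have hab : aeval k α * W ^ 2 + aeval k β * aeval k (derivative P) = 1 := by
    rw [hW, ← map_mul, ← map_mul, ← map_add, hαβ, map_one]
  obtain ⟨j, rfl⟩ : ∃ j, m = j + 2 := ⟨m - 2, by omega⟩
  have key : D h / w = -(k ^ j * aeval k α * W * D k + k ^ j * (2 * aeval k β) * D W) := by
    have h1 : D h = - D k / k ^ 2 := by rw [hDh]; field_simp
    have h2 : w = W / k ^ (j + 2) := by rw [hWdef]; field_simp
    have h3 : D k = aeval k α * W ^ 2 * D k + aeval k β * (2 * W * D W) := by
      rw [hDW]; linear_combination (-D k) * hab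
    rw [h1, h2]
    field_simp
    linear_combination (-k ^ (j + 2)) * h3
  have hkj : k ^ j ∈ H.integers := pow_mem hk j
  have hA := H.trace_mul_deriv_mem (mul_mem (mul_mem hkj (hmem α)) hWmem) hk
  have hB := H.trace_mul_deriv_mem
    (mul_mem hkj (mul_mem (H.integers.algebraMap_mem 2) (hmem β))) hWmem
  rw [map_ofNat] at hB
  rw [key]
  convert neg_mem (add_mem hA hB) using 1
  simp only [map_neg, map_add]
  ring

end IsInvariantValuationRing

end TraceLemma

section DerivationExtension

theorem exists_derivation_of_formallyEtale {k S T : Type} [CommRing k] [CommRing S] [CommRing T]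
    [Algebra k S] [Algebra k T] [Algebra S T] [IsScalarTower k S T] [Algebra.FormallyEtale S T]
    (d : Derivation k S T) : ∃ D : Derivation k T T, ∀ s, D (algebraMap S T s) = d s := by
  let l : Ω[T⁄k] →ₗ[T] T := (d.liftKaehlerDifferential.liftBaseChange T).comp
    (KaehlerDifferential.tensorKaehlerEquivOfFormallyEtale k S T).symm.toLinearMap
  refine ⟨l.compDer (KaehlerDifferential.D k T), fun s => ?_⟩
  change (d.liftKaehlerDifferential.liftBaseChange T)
    ((KaehlerDifferential.tensorKaehlerEquivOfFormallyEtale k S T).symm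
      (KaehlerDifferential.D k T (algebraMap S T s))) = d s
  rw [KaehlerDifferential.tensorKaehlerEquivOfFormallyEtale_symm_D_algebraMap]
  simp

theorem derivation_eq_zero_of_formallyUnramified {k S T : Type} [CommRing k] [CommRing S]
    [CommRing T] [Algebra k S] [Algebra k T] [Algebra S T] [IsScalarTower k S T]
    [Algebra.FormallyUnramified S T] (D : Derivation k T T)
    (h : ∀ s, D (algebraMap S T s) = 0) : D = 0 := by
  let D' : Derivation S T T := Derivation.mk'
    { toFun := D
      map_add' := D.map_add
      map_smul' := fun s x => by
        rw [Algebra.smul_def, D.leibniz, h, smul_zero, add_zero, RingHom.id_apply,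
          algebraMap_smul] }
    fun a b => D.leibniz a b
  have h0 : D' = 0 := by
    rw [← D'.liftKaehlerDifferential_comp, Subsingleton.elim D'.liftKaehlerDifferential 0]
    rfl
  ext x
  exact congrArg (fun E : Derivation S T T => E x) h0

variable {k L ι : Type} [Field k] [CharZero k] [Field L] [Algebra k L] {x : ι → L}

theorem IsTranscendenceBasis.exists_formallyEtale (hx : IsTranscendenceBasis k x) :
    ∃ _ : Algebra (MvPolynomial ι k) L, IsScalarTower k (MvPolynomial ι k) L ∧
      (∀ i, algebraMap (MvPolynomial ι k) L (MvPolynomial.X i) = x i) ∧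
      Algebra.FormallyEtale (MvPolynomial ι k) L := by
  let := (MvPolynomial.aeval (R := k) x).toAlgebra
  have htower : IsScalarTower k (MvPolynomial ι k) L := IsScalarTower.of_algebraMap_eq' <| by
    ext c; exact (MvPolynomial.aeval_C x c).symm
  have hinj : Function.Injective (algebraMap (MvPolynomial ι k) L) := hx.1
  have : FaithfulSMul (MvPolynomial ι k) L := (faithfulSMul_iff_algebraMap_injective _ _).mpr hinj
  let : Algebra (FractionRing (MvPolynomial ι k)) L := FractionRing.liftAlgebra _ L
  have : IsScalarTower (MvPolynomial ι k) (FractionRing (MvPolynomial ι k)) L :=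
    FractionRing.isScalarTower_liftAlgebra _ L
  have halg : Algebra.IsAlgebraic (MvPolynomial ι k) L := by
    have := hx.isAlgebraic
    exact Algebra.IsAlgebraic.of_ringHom_of_comp_eq (S := Algebra.adjoin k (Set.range x)) (B := L)
      hx.1.aevalEquiv (RingHom.id L) hx.1.aevalEquiv.surjective Function.injective_id
      (RingHom.ext fun p => hx.1.algebraMap_aevalEquiv p)
  have : Algebra.IsAlgebraic (FractionRing (MvPolynomial ι k)) L :=
    IsFractionRing.comap_isAlgebraic_iff (A := MvPolynomial ι k).mp halg
  have : CharZero (FractionRing (MvPolynomial ι k)) :=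
    charZero_of_injective_algebraMap (algebraMap k _).injective
  have : Algebra.FormallyEtale (MvPolynomial ι k) (FractionRing (MvPolynomial ι k)) :=
    Algebra.FormallyEtale.of_isLocalization (nonZeroDivisors _)
  have : Algebra.FormallyEtale (FractionRing (MvPolynomial ι k)) L :=
    Algebra.FormallyEtale.of_isSeparable _ _
  exact ⟨_, htower, fun i => MvPolynomial.aeval_X x i,
    Algebra.FormallyEtale.comp _ (FractionRing (MvPolynomial ι k)) _⟩

theorem IsTranscendenceBasis.exists_derivation (hx : IsTranscendenceBasis k x) (v : ι → L) :
    ∃ D : Derivation k L L, ∀ i, D (x i) = v i := by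
  obtain ⟨_, _, hX, _⟩ := hx.exists_formallyEtale
  obtain ⟨D, hD⟩ := exists_derivation_of_formallyEtale (MvPolynomial.mkDerivation k v)
  exact ⟨D, fun i => by rw [← hX, hD, MvPolynomial.mkDerivation_X]⟩

theorem IsTranscendenceBasis.derivation_ext (hx : IsTranscendenceBasis k x)
    {D D' : Derivation k L L} (h : ∀ i, D (x i) = D' (x i)) : D = D' := by
  obtain ⟨_, _, hX, _⟩ := hx.exists_formallyEtale
  refine sub_eq_zero.mp (derivation_eq_zero_of_formallyUnramified (S := MvPolynomial ι k) _ ?_)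
  have : (D - D').compAlgebraMap (MvPolynomial ι k) = 0 := MvPolynomial.derivation_ext fun i => by
    change (D - D') (algebraMap _ L (MvPolynomial.X i)) = 0
    rw [hX, Derivation.sub_apply, h, sub_self]
  exact fun s => congrArg (fun E : Derivation k (MvPolynomial ι k) L => E s) this

theorem exists_derivation_apply_eq_one {F L : Type} [Field F] [CharZero F] [Field L] [Algebra F L]
    {y : L} (hy : Transcendental F y) : ∃ D : Derivation F L L, D y = 1 := by
  classical
  have hind : AlgebraicIndependent F ((↑) : ({y} : Set L) → L) := by
    rw [algebraicIndependent_singleton_iff ⟨y, rfl⟩]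
    exact hy
  obtain ⟨s, hs, hb⟩ := exists_isTranscendenceBasis_superset hind
  obtain ⟨D, hD⟩ := hb.exists_derivation fun _ => 1
  exact ⟨D, hD ⟨y, hs rfl⟩⟩

end DerivationExtension

section Poles

variable {k L ι : Type} [Field k] [Field L] [Algebra k L] [Algebra (MvPolynomial ι k) L]
  [IsScalarTower k (MvPolynomial ι k) L]

/-- The image in `L` of the localization of the polynomial ring at the prime `π`. -/
def primeSubalgebra {π : MvPolynomial ι k} (hπ : Prime π) : Subalgebra k L where
  carrier := {y | ∃ a b : MvPolynomial ι k, ¬ π ∣ b ∧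
    y * algebraMap (MvPolynomial ι k) L b = algebraMap (MvPolynomial ι k) L a}
  algebraMap_mem' c := ⟨algebraMap _ _ c, 1, fun h => hπ.not_isUnit (isUnit_of_dvd_one h), by
    rw [map_one, mul_one, ← IsScalarTower.algebraMap_apply]⟩
  add_mem' := by
    rintro y z ⟨a, b, hb, hy⟩ ⟨c, d, hd, hz⟩
    refine ⟨a * d + c * b, b * d, fun h => (hπ.dvd_or_dvd h).elim hb hd, ?_⟩
    simp only [map_add, map_mul, ← hy, ← hz]
    ring
  mul_mem' := by
    rintro y z ⟨a, b, hb, hy⟩ ⟨c, d, hd, hz⟩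
    refine ⟨a * c, b * d, fun h => (hπ.dvd_or_dvd h).elim hb hd, ?_⟩
    simp only [map_mul, ← hy, ← hz]
    ring

variable (k L ι) in
/-- The image in `L` of the ring of rational functions regular at the hyperplane at infinity. -/
def infinitySubalgebra : Subalgebra k L where
  carrier := {y | ∃ a b : MvPolynomial ι k, b ≠ 0 ∧ a.totalDegree ≤ b.totalDegree ∧
    y * algebraMap (MvPolynomial ι k) L b = algebraMap (MvPolynomial ι k) L a}
  algebraMap_mem' c := ⟨algebraMap _ _ c, 1, one_ne_zero,
    by rw [MvPolynomial.algebraMap_eq, MvPolynomial.totalDegree_C]; exact Nat.zero_le _, by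
    rw [map_one, mul_one, ← IsScalarTower.algebraMap_apply]⟩
  add_mem' := by
    rintro y z ⟨a, b, hb, hab, hy⟩ ⟨c, d, hd, hcd, hz⟩
    refine ⟨a * d + c * b, b * d, mul_ne_zero hb hd, ?_, ?_⟩
    · rw [MvPolynomial.totalDegree_mul_of_isDomain hb hd]
      refine (MvPolynomial.totalDegree_add _ _).trans (max_le ?_ ?_)
      · have := MvPolynomial.totalDegree_mul a d
        omega
      · have := MvPolynomial.totalDegree_mul c b
        omega
    · simp only [map_add, map_mul, ← hy, ← hz]
      ring
  mul_mem' := by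
    rintro y z ⟨a, b, hb, hab, hy⟩ ⟨c, d, hd, hcd, hz⟩
    refine ⟨a * c, b * d, mul_ne_zero hb hd, ?_, ?_⟩
    · rw [MvPolynomial.totalDegree_mul_of_isDomain hb hd]
      have := MvPolynomial.totalDegree_mul a c
      omega
    · simp only [map_mul, ← hy, ← hz]
      ring

theorem deriv_mul_sq {D : Derivation k L L} {y a b : L} (h : y * b = a) :
    D y * b ^ 2 = D a * b - a * D b := by
  rw [← h, D.leibniz, smul_eq_mul, smul_eq_mul]
  ring

theorem totalDegree_X_mul_pderiv_le (i j : ι) (p : MvPolynomial ι k) :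
    (MvPolynomial.X j * MvPolynomial.pderiv i p).totalDegree ≤ p.totalDegree := by
  classical
  conv_lhs => rw [p.as_sum, map_sum, Finset.mul_sum]
  refine MvPolynomial.totalDegree_finsetSum_le fun s hs => ?_
  refine le_trans ?_ (MvPolynomial.le_totalDegree hs)
  rw [MvPolynomial.pderiv_monomial]
  by_cases h0 : s i = 0
  · simp [h0]
  · refine (MvPolynomial.totalDegree_mul _ _).trans ?_
    rw [MvPolynomial.totalDegree_X]
    have h1 := MvPolynomial.totalDegree_monomial_le (s - Finsupp.single i 1)
      (p.coeff s * (s i : k))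
    have h2 : Finsupp.single i 1 ≤ s := by
      rw [Finsupp.single_le_iff]; omega
    have h3 : s.sum (fun _ e => e) =
        (s - Finsupp.single i 1).sum (fun _ e => e) + 1 := by
      conv_lhs => rw [← tsub_add_cancel_of_le h2]
      rw [Finsupp.sum_add_index' (fun _ => rfl) (fun _ _ _ => rfl), Finsupp.sum_single_index rfl]
    have h4 : ((s - Finsupp.single i 1).sum fun _ => id) =
        (s - Finsupp.single i 1).sum (fun _ e => e) := rfl
    omega

theorem deriv_mem_primeSubalgebra {π : MvPolynomial ι k} (hπ : Prime π) {D : Derivation k L L}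
    {d : MvPolynomial ι k → MvPolynomial ι k}
    (hD : ∀ p, D (algebraMap (MvPolynomial ι k) L p) = algebraMap (MvPolynomial ι k) L (d p))
    {y : L} (hy : y ∈ primeSubalgebra (L := L) hπ) : D y ∈ primeSubalgebra (L := L) hπ := by
  obtain ⟨a, b, hb, h⟩ := hy
  refine ⟨d a * b - a * d b, b ^ 2, fun h => hb (hπ.dvd_of_dvd_pow h), ?_⟩
  rw [map_pow, deriv_mul_sq h, hD, hD, map_sub, map_mul, map_mul]

theorem deriv_mem_infinitySubalgebra {D : Derivation k L L}
    {d : MvPolynomial ι k → MvPolynomial ι k}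
    (hd : ∀ p, (d p).totalDegree ≤ p.totalDegree)
    (hD : ∀ p, D (algebraMap (MvPolynomial ι k) L p) = algebraMap (MvPolynomial ι k) L (d p))
    {y : L} (hy : y ∈ infinitySubalgebra k L ι) : D y ∈ infinitySubalgebra k L ι := by
  obtain ⟨a, b, hb, hab, h⟩ := hy
  refine ⟨d a * b - a * d b, b ^ 2, pow_ne_zero 2 hb, ?_, ?_⟩
  · rw [pow_two, MvPolynomial.totalDegree_mul_of_isDomain hb hb]
    refine (MvPolynomial.totalDegree_sub _ _).trans (max_le ?_ ?_)
    · have := MvPolynomial.totalDegree_mul (d a) b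
      have := hd a
      omega
    · have := MvPolynomial.totalDegree_mul a (d b)
      have := hd b
      omega
  · rw [map_pow, deriv_mul_sq h, hD, hD, map_sub, map_mul, map_mul]

theorem exists_isRelPrime_of_mul_eq {k L ι : Type} [Field k] [Field L]
    [Algebra (MvPolynomial ι k) L]
    (hinj : Function.Injective (algebraMap (MvPolynomial ι k) L)) {y : L} {a b : MvPolynomial ι k} (hb : b ≠ 0)
    (h : y * algebraMap (MvPolynomial ι k) L b = algebraMap (MvPolynomial ι k) L a) :
    ∃ a b : MvPolynomial ι k, b ≠ 0 ∧ IsRelPrime a b ∧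
      y * algebraMap (MvPolynomial ι k) L b = algebraMap (MvPolynomial ι k) L a := by
  obtain ⟨a', b', c', hrel, rfl, rfl⟩ :=
    UniqueFactorizationMonoid.exists_reduced_factors' a b hb
  have hc : c' ≠ 0 := left_ne_zero_of_mul hb
  refine ⟨a', b', right_ne_zero_of_mul hb, hrel, ?_⟩
  have hc' : algebraMap (MvPolynomial ι k) L c' ≠ 0 := by
    rwa [Ne, map_eq_zero_iff _ hinj]
  refine mul_left_cancel₀ hc' ?_
  rw [map_mul, map_mul] at h
  rw [← h]; ring

theorem mem_or_inv_mem_primeSubalgebra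
    (hinj : Function.Injective (algebraMap (MvPolynomial ι k) L))
    {π : MvPolynomial ι k} (hπ : Prime π) {y : L}
    {a b : MvPolynomial ι k} (hb : b ≠ 0)
    (h : y * algebraMap (MvPolynomial ι k) L b = algebraMap (MvPolynomial ι k) L a) :
    y ∈ primeSubalgebra (L := L) hπ ∨ y⁻¹ ∈ primeSubalgebra (L := L) hπ := by
  obtain ⟨a, b, hb, hrel, h⟩ := exists_isRelPrime_of_mul_eq hinj hb h
  by_cases hπb : π ∣ b
  · right
    have hπa : ¬ π ∣ a := fun hπa => hπ.not_isUnit (hrel hπa hπb)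
    refine ⟨b, a, hπa, ?_⟩
    have ha : algebraMap (MvPolynomial ι k) L a ≠ 0 := by
      rw [Ne, map_eq_zero_iff _ hinj]; rintro rfl; exact hπa (dvd_zero _)
    have hy : y ≠ 0 := by rintro rfl; rw [zero_mul] at h; exact ha h.symm
    rw [← h, inv_mul_cancel_left₀ hy]
  · exact Or.inl ⟨a, b, hπb, h⟩

theorem mem_or_inv_mem_infinitySubalgebra
    (hinj : Function.Injective (algebraMap (MvPolynomial ι k) L))
    {y : L} {a b : MvPolynomial ι k} (hb : b ≠ 0)
    (h : y * algebraMap (MvPolynomial ι k) L b = algebraMap (MvPolynomial ι k) L a) :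
    y ∈ infinitySubalgebra k L ι ∨ y⁻¹ ∈ infinitySubalgebra k L ι := by
  rcases le_total a.totalDegree b.totalDegree with hle | hle
  · exact Or.inl ⟨a, b, hb, hle, h⟩
  by_cases ha : a = 0
  · exact Or.inl ⟨a, b, hb, by rw [ha, MvPolynomial.totalDegree_zero]; exact Nat.zero_le _, h⟩
  · right
    refine ⟨b, a, ha, hle, ?_⟩
    have ha : algebraMap (MvPolynomial ι k) L a ≠ 0 := by
      rwa [Ne, map_eq_zero_iff _ hinj]
    have hy : y ≠ 0 := by rintro rfl; rw [zero_mul] at h; exact ha h.symm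
    rw [← h, inv_mul_cancel_left₀ hy]

theorem exists_algebraMap_eq_of_forall_mem_primeSubalgebra
    (hinj : Function.Injective (algebraMap (MvPolynomial ι k) L))
    {y : L} {a b : MvPolynomial ι k}
    (hb : b ≠ 0)
    (h : y * algebraMap (MvPolynomial ι k) L b = algebraMap (MvPolynomial ι k) L a)
    (hy : ∀ (π : MvPolynomial ι k) (hπ : Prime π), y ∈ primeSubalgebra (L := L) hπ) :
    ∃ p, algebraMap (MvPolynomial ι k) L p = y := by
  obtain ⟨a, b, hb, hrel, h⟩ := exists_isRelPrime_of_mul_eq hinj hb h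
  have hu : IsUnit b := by
    by_contra hu
    obtain ⟨π, hirr, hπb⟩ := WfDvdMonoid.exists_irreducible_factor hu hb
    have hπ := hirr.prime
    obtain ⟨c, d, hd, hcd⟩ := hy π hπ
    have h1 : a * d = c * b := hinj <| by
      rw [map_mul, map_mul, ← h, ← hcd]; ring
    have h2 : π ∣ a * d := h1 ▸ hπb.mul_left c
    exact hπ.not_isUnit (hrel ((hπ.dvd_or_dvd h2).resolve_right hd) hπb)
  obtain ⟨u, rfl⟩ := hu
  refine ⟨a * ↑u⁻¹, ?_⟩
  rw [map_mul, ← h, mul_assoc, ← map_mul, Units.mul_inv, map_one, mul_one]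

theorem eq_zero_of_X_mul_mem_infinitySubalgebra
    (hinj : Function.Injective (algebraMap (MvPolynomial ι k) L))
    (j : ι) (p : MvPolynomial ι k)
    (h : algebraMap (MvPolynomial ι k) L (MvPolynomial.X j * p) ∈ infinitySubalgebra k L ι) :
    p = 0 := by
  by_contra hp
  obtain ⟨a, b, hb, hab, h⟩ := h
  rw [← map_mul] at h
  have h1 := hinj h
  have hX : (MvPolynomial.X j : MvPolynomial ι k) ≠ 0 := MvPolynomial.X_ne_zero j
  rw [← h1, MvPolynomial.totalDegree_mul_of_isDomain (mul_ne_zero hX hp) hb,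
    MvPolynomial.totalDegree_mul_of_isDomain hX hp, MvPolynomial.totalDegree_X] at hab
  omega

end Poles

section VanishingTrace

variable {k L ι : Type} [Field k] [Field L] [Algebra k L]

theorem derivation_sum_smul_apply [Fintype ι] (f : ι → L) (P : ι → Derivation k L L) (y : L) :
    (∑ i, f i • P i) y = ∑ i, f i * P i y := by
  have := congrFun (map_sum (Derivation.coeFnAddMonoidHom (R := k) (A := L) (M := L))
    (fun i => f i • P i) Finset.univ) y
  rw [Finset.sum_apply] at this
  exact this

/-- The conjugate of a derivation under an automorphism. -/
def conjDerivation (σ : L ≃ₐ[k] L) (D : Derivation k L L) : Derivation k L L :=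
  Derivation.mk' (σ.symm.toLinearMap ∘ₗ D.toLinearMap ∘ₗ σ.toLinearMap) fun a b => by
    change σ.symm (D (σ (a * b))) = a • σ.symm (D (σ b)) + b • σ.symm (D (σ a))
    simp only [map_mul, D.leibniz, map_add, smul_eq_mul, AlgEquiv.symm_apply_apply]

variable [CharZero k] [Algebra (MvPolynomial ι k) L] [IsScalarTower k (MvPolynomial ι k) L]

theorem exists_partial_derivations [DecidableEq ι]
    (hx : IsTranscendenceBasis k fun i => algebraMap (MvPolynomial ι k) L (MvPolynomial.X i))
    {σ : L ≃ₐ[k] L}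
    (hσ : ∀ p, σ (algebraMap (MvPolynomial ι k) L p) = algebraMap (MvPolynomial ι k) L p) :
    ∃ D : ι → Derivation k L L, (∀ i p, D i (algebraMap (MvPolynomial ι k) L p) =
      algebraMap (MvPolynomial ι k) L (MvPolynomial.pderiv i p)) ∧
      ∀ i y, D i (σ y) = σ (D i y) := by
  choose D hD using fun i : ι => hx.exists_derivation (Pi.single i (1 : L))
  have h1 : ∀ i p, D i (algebraMap (MvPolynomial ι k) L p) =
      algebraMap (MvPolynomial ι k) L (MvPolynomial.pderiv i p) := by
    intro i
    have : (D i).compAlgebraMap (MvPolynomial ι k) =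
        (Algebra.linearMap (MvPolynomial ι k) L).compDer (MvPolynomial.pderiv i) := by
      refine MvPolynomial.derivation_ext fun j => ?_
      change D i (algebraMap _ L (MvPolynomial.X j)) =
        algebraMap _ L (MvPolynomial.pderiv i (MvPolynomial.X j))
      rw [hD, MvPolynomial.pderiv_X]
      by_cases hij : i = j
      · subst hij; simp
      · simp [Pi.single_eq_of_ne (Ne.symm hij)]
    exact fun p => congrArg (fun E : Derivation k (MvPolynomial ι k) L => E p) this
  refine ⟨D, h1, fun i y => ?_⟩
  have h2 : conjDerivation σ (D i) = D i := hx.derivation_ext fun j => by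
    change σ.symm (D i (σ (algebraMap _ L (MvPolynomial.X j)))) = _
    rw [hσ, h1, AlgEquiv.symm_apply_eq, hσ]
  have h3 : σ.symm (D i (σ y)) = D i y := congrArg (fun E : Derivation k L L => E y) h2
  rw [← h3, AlgEquiv.apply_symm_apply]

theorem deriv_div_add_deriv_conj_div_eq_zero [Finite ι] [Nonempty ι]
    (hx : IsTranscendenceBasis k fun i => algebraMap (MvPolynomial ι k) L (MvPolynomial.X i))
    {σ : L ≃ₐ[k] L} (hσ2 : ∀ y, σ (σ y) = y)
    (hσ : ∀ p, σ (algebraMap (MvPolynomial ι k) L p) = algebraMap (MvPolynomial ι k) L p)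
    (hfix : ∀ y, σ y = y → ∃ a b : MvPolynomial ι k, b ≠ 0 ∧
      y * algebraMap (MvPolynomial ι k) L b = algebraMap (MvPolynomial ι k) L a)
    {h w : L} (hh : ∀ c : k, h ≠ algebraMap k L c) {s : Finset k} (hs : 3 ≤ s.card)
    (hw : w ^ 2 = ∏ r ∈ s, (h - algebraMap k L r)) (D : Derivation k L L) :
    D h / w + D (σ h) / σ w = 0 := by
  classical
  have := Fintype.ofFinite ι
  have hinj : Function.Injective (algebraMap (MvPolynomial ι k) L) := by
    have h1 := hx.1
    have h2 : MvPolynomial.aeval (fun i => algebraMap (MvPolynomial ι k) L (MvPolynomial.X i)) =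
        IsScalarTower.toAlgHom k (MvPolynomial ι k) L := by
      ext i; simp
    rw [AlgebraicIndependent, h2] at h1
    exact h1
  obtain ⟨P, hP, hPσ⟩ := exists_partial_derivations hx hσ
  have hTσ : ∀ i, σ (P i h / w + σ (P i h / w)) = P i h / w + σ (P i h / w) := fun i => by
    rw [map_add, hσ2, add_comm]
  have hprime : ∀ i (π : MvPolynomial ι k) (hπ : Prime π),
      P i h / w + σ (P i h / w) ∈ primeSubalgebra (L := L) hπ := fun i π hπ =>
    IsInvariantValuationRing.trace_deriv_div_mem (σ := σ) (D := P i)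
      { involutive := hσ2
        fixed := by
          rintro y ⟨a, b, hb, h⟩
          have hb0 : algebraMap (MvPolynomial ι k) L b ≠ 0 := by
            rw [Ne, map_eq_zero_iff _ hinj]; rintro rfl; exact hb (dvd_zero _)
          rw [eq_div_of_mul_eq hb0 h, map_div₀, hσ, hσ]
        mem_or_inv_mem := fun y hy => by
          obtain ⟨a, b, hb, h⟩ := hfix y hy
          exact mem_or_inv_mem_primeSubalgebra hinj hπ hb h
        comm := hPσ i
        deriv_mem := fun y hy => deriv_mem_primeSubalgebra hπ (hP i) hy } hh hs hw
  have hinfty : ∀ i j, algebraMap (MvPolynomial ι k) L (MvPolynomial.X j) *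
      (P i h / w + σ (P i h / w)) ∈ infinitySubalgebra k L ι := fun i j => by
    have := IsInvariantValuationRing.trace_deriv_div_mem (σ := σ)
      (R := infinitySubalgebra k L ι)
      (D := algebraMap (MvPolynomial ι k) L (MvPolynomial.X j) • P i)
      { involutive := hσ2
        fixed := by
          rintro y ⟨a, b, hb, -, h⟩
          have hb0 : algebraMap (MvPolynomial ι k) L b ≠ 0 := by
            rwa [Ne, map_eq_zero_iff _ hinj]
          rw [eq_div_of_mul_eq hb0 h, map_div₀, hσ, hσ]
        mem_or_inv_mem := fun y hy => by
          obtain ⟨a, b, hb, h⟩ := hfix y hy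
          exact mem_or_inv_mem_infinitySubalgebra hinj hb h
        comm := fun y => by
          rw [Derivation.smul_apply, Derivation.smul_apply, smul_eq_mul, smul_eq_mul, map_mul, hσ,
            hPσ]
        deriv_mem := fun y hy => deriv_mem_infinitySubalgebra
          (d := fun p => MvPolynomial.X j * MvPolynomial.pderiv i p)
          (totalDegree_X_mul_pderiv_le i j)
          (fun p => by rw [Derivation.smul_apply, smul_eq_mul, hP, map_mul]) hy } hh hs hw
    rw [Derivation.smul_apply, smul_eq_mul, mul_div_assoc, map_mul, hσ, ← mul_add] at this
    exact this
  have hT : ∀ i, P i h / w + σ (P i h / w) = 0 := fun i => by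
    obtain ⟨a, b, hb, hab⟩ := hfix _ (hTσ i)
    obtain ⟨p, hp⟩ := exists_algebraMap_eq_of_forall_mem_primeSubalgebra hinj hb hab (hprime i)
    obtain ⟨j⟩ := ‹Nonempty ι›
    have h1 := hinfty i j
    rw [← hp, ← map_mul] at h1
    rw [← hp, eq_zero_of_X_mul_mem_infinitySubalgebra hinj j p h1, map_zero]
  have hD : D = ∑ i, D (algebraMap (MvPolynomial ι k) L (MvPolynomial.X i)) • P i :=
    hx.derivation_ext fun j => by
      simp only [derivation_sum_smul_apply, hP, MvPolynomial.pderiv_X]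
      rw [Finset.sum_eq_single j]
      · simp
      · intro i _ hij
        simp [Pi.single_eq_of_ne hij.symm]
      · simp
  rw [hD]
  simp only [derivation_sum_smul_apply, Finset.sum_div, hPσ, mul_div_assoc, ← map_div₀]
  rw [← Finset.sum_add_distrib]
  refine Finset.sum_eq_zero fun i _ => ?_
  rw [← mul_add, hT, mul_zero]

/-- If `σ h` were transcendental over a subfield containing `h` and `w`, some derivation would
separate `h` from `σ h`. -/
theorem not_transcendental_conj [Finite ι] [Nonempty ι]
    (hx : IsTranscendenceBasis k fun i => algebraMap (MvPolynomial ι k) L (MvPolynomial.X i))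
    {σ : L ≃ₐ[k] L} (hσ2 : ∀ y, σ (σ y) = y)
    (hσ : ∀ p, σ (algebraMap (MvPolynomial ι k) L p) = algebraMap (MvPolynomial ι k) L p)
    (hfix : ∀ y, σ y = y → ∃ a b : MvPolynomial ι k, b ≠ 0 ∧
      y * algebraMap (MvPolynomial ι k) L b = algebraMap (MvPolynomial ι k) L a)
    {F : Type} [Field F] [Algebra k F] [Algebra F L] [IsScalarTower k F L] {h w : F}
    (hh : Transcendental k h) {s : Finset k} (hs : 3 ≤ s.card)
    (hw : w ^ 2 = ∏ r ∈ s, (h - algebraMap k F r)) :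
    ¬ Transcendental F (σ (algebraMap F L h)) := by
  intro hy
  have : CharZero F := charZero_of_injective_algebraMap (algebraMap k F).injective
  obtain ⟨D, hD⟩ := exists_derivation_apply_eq_one hy
  have hc : ∀ c : k, h ≠ algebraMap k F c := by
    rintro c rfl
    exact hh (isAlgebraic_algebraMap c)
  have hw0 : w ≠ 0 := by
    rintro rfl
    rw [zero_pow two_ne_zero, eq_comm, Finset.prod_eq_zero_iff] at hw
    obtain ⟨r, -, hr⟩ := hw
    exact hc r (sub_eq_zero.mp hr)
  have key := deriv_div_add_deriv_conj_div_eq_zero hx hσ2 hσ hfix (h := algebraMap F L h)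
    (w := algebraMap F L w) (s := s)
    (fun c hcc => hc c <| (algebraMap F L).injective <| by
      rw [hcc, ← IsScalarTower.algebraMap_apply]) hs
    (by rw [← map_pow, hw, map_prod]; simp only [map_sub, ← IsScalarTower.algebraMap_apply])
    (D.restrictScalars k)
  simp only [Derivation.restrictScalars_apply, Derivation.map_algebraMap, hD, zero_div,
    zero_add, one_div, inv_eq_zero, map_eq_zero] at key
  exact hw0 key

end VanishingTrace

section QuadraticExtensions

theorem exists_conjugation (K L : Type) [Field K] [CharZero K] [Field L] [Algebra K L]
    [FiniteDimensional K L] (h2 : Module.finrank K L ≤ 2) :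
    ∃ σ : L ≃ₐ[K] L, (∀ y, σ (σ y) = y) ∧
      (∀ y, σ y = y → y ∈ Set.range (algebraMap K L)) ∧ ∀ τ : L ≃ₐ[K] L, τ = 1 ∨ τ = σ := by
  have hpos : 0 < Module.finrank K L := Module.finrank_pos
  have hGal : IsGalois K L := by
    obtain h | h : Module.finrank K L = 1 ∨ Module.finrank K L = 2 := by omega
    · have hbij := Algebra.finrank_eq_one_iff_bijective_algebraMap.mp h
      exact IsGalois.of_algEquiv (AlgEquiv.ofBijective (Algebra.ofId K L) hbij)
    · have : Algebra.IsQuadraticExtension K L := { finrank_eq_two' := h }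
      infer_instance
  have hcard : Nat.card (L ≃ₐ[K] L) ≤ 2 := (IsGalois.card_aut_eq_finrank K L).trans_le h2
  obtain ⟨σ, hσ⟩ : ∃ σ : L ≃ₐ[K] L, ∀ τ : L ≃ₐ[K] L, τ = 1 ∨ τ = σ := by
    by_contra! hcon
    obtain ⟨τ₁, h1, -⟩ := hcon 1
    obtain ⟨τ₂, h2, h3⟩ := hcon τ₁
    have := Nat.card_le_card_of_injective ![1, τ₁, τ₂] (by
      intro i j hij
      fin_cases i <;> fin_cases j <;> simp_all [eq_comm])
    rw [Nat.card_eq_fintype_card, Fintype.card_fin] at this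
    omega
  refine ⟨σ, fun y => ?_, fun y hy => ?_, hσ⟩
  · rcases hσ (σ * σ) with h | h
    · exact congrArg (fun τ : L ≃ₐ[K] L => τ y) h
    · have : σ = 1 := mul_eq_left.mp h
      rw [this]; rfl
  · rw [IsGalois.mem_range_algebraMap_iff_fixed]
    intro τ
    rcases hσ τ with rfl | rfl
    · rfl
    · exact hy

theorem conj_comm {k K L : Type} [Field k] [Field K] [Field L] [Algebra k K] [Algebra k L]
    [Algebra K L] {σ : L ≃ₐ[K] L} (hσ : ∀ τ : L ≃ₐ[K] L, τ = 1 ∨ τ = σ) (g : L ≃ₐ[k] L)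
    (gK : K ≃ₐ[k] K) (hg : ∀ x, g (algebraMap K L x) = algebraMap K L (gK x)) (y : L) :
    g (σ y) = σ (g y) := by
  have hg' : ∀ x, g.symm (algebraMap K L x) = algebraMap K L (gK.symm x) := fun x => by
    rw [AlgEquiv.symm_apply_eq, hg, AlgEquiv.apply_symm_apply]
  let τ : L ≃ₐ[K] L := AlgEquiv.ofRingEquiv
    (f := (g.toRingEquiv.trans σ.toRingEquiv).trans g.symm.toRingEquiv) fun x => by
      change g.symm (σ (g (algebraMap K L x))) = _
      rw [hg, σ.commutes, hg', AlgEquiv.symm_apply_apply]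
  have hτ : ∀ z, g (τ z) = σ (g z) := fun z => g.apply_symm_apply _
  rcases hσ τ with h | h
  · have h1 : ∀ z, σ z = z := fun z => by
      obtain ⟨z, rfl⟩ := g.surjective z
      rw [← hτ, h]; rfl
    rw [h1, h1]
  · rw [← hτ, h]

end QuadraticExtensions

section GroupActions

variable {k K G : Type} [Field k] [Field K] [Algebra k K] [Group G]

/-- The action induced on a stable intermediate field. -/
def restrictAction (ρ : G →* (K ≃ₐ[k] K)) (S : IntermediateField k K)
    (hS : ∀ g, ∀ z ∈ S, ρ g z ∈ S) : G →* (S ≃ₐ[k] S) where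
  toFun g :=
    { toFun := fun z => ⟨ρ g z, hS g z z.2⟩
      invFun := fun z => ⟨ρ g⁻¹ z, hS g⁻¹ z z.2⟩
      left_inv := fun z => Subtype.ext <| by
        change (ρ g⁻¹ * ρ g) z = z
        rw [← map_mul, inv_mul_cancel, map_one]; rfl
      right_inv := fun z => Subtype.ext <| by
        change (ρ g * ρ g⁻¹) z = z
        rw [← map_mul, mul_inv_cancel, map_one]; rfl
      map_mul' := fun x y => Subtype.ext <| map_mul (ρ g) (x : K) y
      map_add' := fun x y => Subtype.ext <| map_add (ρ g) (x : K) y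
      commutes' := fun c => Subtype.ext <| (ρ g).commutes c }
  map_one' := AlgEquiv.ext fun z => Subtype.ext <| by
    change ρ 1 (z : K) = z
    rw [map_one]; rfl
  map_mul' g h := AlgEquiv.ext fun z => Subtype.ext <| by
    change ρ (g * h) (z : K) = ρ g (ρ h z)
    rw [map_mul]; rfl

theorem exists_transcendental_of_faithful [IsAlgClosed k] [Nontrivial G] {ρ : G →* (K ≃ₐ[k] K)}
    (hρ : Function.Injective ρ) : ∃ x : K, Transcendental k x := by
  obtain ⟨g, hg⟩ := exists_ne (1 : G)
  by_contra! hcon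
  refine hg (hρ ?_)
  ext y
  have : ∃ c : k, algebraMap k K c = y := by
    by_contra! h
    exact hcon y (transcendental_of_forall_algebraMap_ne h)
  obtain ⟨c, rfl⟩ := this
  rw [AlgEquiv.commutes, AlgEquiv.commutes]

theorem exists_finset_generators [Finite G] [Algebra.EssFiniteType k K]
    (ρ : G →* (K ≃ₐ[k] K)) : ∃ t : Finset K, IntermediateField.adjoin k (t : Set K) = ⊤ ∧
      ∀ g, ∀ f ∈ t, ρ g f ∈ t := by
  classical
  have := Fintype.ofFinite G
  obtain ⟨t, ht⟩ := IntermediateField.fg_top_iff.mpr ‹Algebra.EssFiniteType k K›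
  refine ⟨Finset.univ.biUnion fun g => t.image (ρ g), ?_, fun g f hf => ?_⟩
  · rw [eq_top_iff, ← ht]
    refine IntermediateField.adjoin.mono _ _ _ fun x hx => ?_
    simp only [Finset.coe_biUnion, Set.mem_iUnion, Finset.mem_coe, Finset.mem_image]
    exact ⟨1, Finset.mem_univ _, x, hx, by rw [map_one]; rfl⟩
  · simp only [Finset.mem_biUnion, Finset.mem_image, Finset.mem_univ, true_and] at hf ⊢
    obtain ⟨g', x, hx, rfl⟩ := hf
    exact ⟨g * g', x, hx, by rw [map_mul]; rfl⟩

theorem eq_one_of_forall_mem_generators {ρ : G →* (K ≃ₐ[k] K)} (hρ : Function.Injective ρ)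
    {t : Set K} (ht : IntermediateField.adjoin k t = ⊤) {g : G} (h : ∀ f ∈ t, ρ g f = f) :
    g = 1 := by
  refine hρ ?_
  rw [map_one]
  ext y
  have hy : y ∈ IntermediateField.adjoin k t := ht ▸ IntermediateField.mem_top
  change ρ g y = y
  induction hy using IntermediateField.adjoin_induction with
  | mem x hx => exact h x hx
  | algebraMap c => exact (ρ g).commutes c
  | add x y _ _ hx hy => rw [map_add, hx, hy]
  | inv x _ hx => rw [map_inv₀, hx]
  | mul x y _ _ hx hy => rw [map_mul, hx, hy]

theorem mul_comm_of_sq_eq_one (h : ∀ g : G, g * g = 1) (a b : G) : a * b = b * a := by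
  have h1 : ∀ g : G, g⁻¹ = g := fun g => inv_eq_of_mul_eq_one_left (h g)
  rw [← h1 (a * b), mul_inv_rev, h1, h1]

end GroupActions

section ConjugateSubfields

theorem isAlgebraic_apply_of_isAlgebraic_apply {k F L : Type} [Field k] [Field F] [Field L]
    [Algebra k F] [Algebra k L] [Algebra F L] [IsScalarTower k F L] (h1 : Algebra.trdeg k F ≤ 1)
    (τ : F →ₐ[k] L) {h : F} (hh : Transcendental k h) (ha : IsAlgebraic F (τ h)) (f : F) :
    IsAlgebraic F (τ f) := by
  let E := algebraicClosure F L
  let S : IntermediateField k F := (E.restrictScalars k).comap τ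
  have hS : k⟮h⟯ ≤ S := adjoin_simple_le_iff.mpr (mem_algebraicClosure_iff.mpr ha)
  have halg := (isAlgebraic_adjoin_simple_of_trdeg_le_one h1 hh).isAlgebraic f
  let φ : k⟮h⟯ →+* E :=
    { toFun := fun c => ⟨τ c, hS c.2⟩
      map_one' := Subtype.ext (map_one τ)
      map_zero' := Subtype.ext (map_zero τ)
      map_add' := fun x y => Subtype.ext (map_add τ (x : F) y)
      map_mul' := fun x y => Subtype.ext (map_mul τ (x : F) y) }
  have : IsAlgebraic E (τ f) := by
    obtain ⟨p, hp, hp0⟩ := halg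
    refine ⟨p.map φ, (Polynomial.map_ne_zero_iff φ.injective).mpr hp, ?_⟩
    rw [Polynomial.aeval_def, Polynomial.eval₂_map]
    have hc : (algebraMap E L).comp φ = (τ : F →+* L).comp (algebraMap k⟮h⟯ F) := rfl
    rw [Polynomial.aeval_def] at hp0
    rw [hc]
    change Polynomial.eval₂ _ ((τ : F →+* L) f) p = 0
    rw [← Polynomial.hom_eval₂, hp0, map_zero]
  exact this.restrictScalars F

theorem mul_self_apply_of_forall_mem_pair {k F L G : Type} [Field k] [Field F] [Field L]
    [Algebra k F] [Algebra k L] [Algebra F L] [Group G] {ρF : G →* (F ≃ₐ[k] F)}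
    {ρL : G →* (L ≃ₐ[k] L)} (hρ : ∀ g y, ρL g (algebraMap F L y) = algebraMap F L (ρF g y))
    {σ : L →+* L} (hσ : ∀ y, σ (σ y) = y) (hc : ∀ g y, ρL g (σ y) = σ (ρL g y)) {g : G} {f : F}
    (hadd : algebraMap F L (ρF g f) + σ (algebraMap F L (ρF g f)) =
      algebraMap F L f + σ (algebraMap F L f))
    (hmul : algebraMap F L (ρF g f) * σ (algebraMap F L (ρF g f)) =
      algebraMap F L f * σ (algebraMap F L f)) :
    ρF (g * g) f = f := by
  apply (algebraMap F L).injective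
  rw [map_mul, AlgEquiv.mul_apply]
  set a := algebraMap F L f with ha
  set b := algebraMap F L (ρF g f) with hb
  have hab : ρL g a = b := hρ g f
  have h0 : (b - a) * (b - σ a) = 0 := by linear_combination b * hadd - hmul
  rcases mul_eq_zero.mp h0 with h | h
  · have h' : ρF g f = f := (algebraMap F L).injective (sub_eq_zero.mp h)
    rw [h', h']
  · have h' : b = σ a := sub_eq_zero.mp h
    rw [← hρ, ← hb, h', hc, hab, h', hσ]

end ConjugateSubfields

section QuadraticCovers

variable {k K L F G ι : Type} [Field k] [IsAlgClosed k] [CharZero k] [Field K] [Field L]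
  [Algebra (MvPolynomial ι k) K] [IsFractionRing (MvPolynomial ι k) K]
  [Algebra (MvPolynomial ι k) L] [Algebra K L] [IsScalarTower (MvPolynomial ι k) K L]
  [Algebra k K] [IsScalarTower k (MvPolynomial ι k) K]
  [Algebra k L] [IsScalarTower k (MvPolynomial ι k) L] [Finite ι]
  [Field F] [Algebra k F] [Algebra.EssFiniteType k F] [Algebra F L] [IsScalarTower k F L]
  [FiniteDimensional K L]

theorem exists_adjoin_simple_eq_top_of_forall_transcendental [Nonempty ι]
    (h2 : Module.finrank K L ≤ 2) (h1 : Algebra.trdeg k F ≤ 1)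
    {σ : L ≃ₐ[K] L} (hσ2 : ∀ y, σ (σ y) = y)
    (hfix : ∀ y, σ y = y → y ∈ Set.range (algebraMap K L))
    {x : F} (hx : Transcendental k x)
    (hσ : ∀ h : F, Transcendental k h → Transcendental F (σ (algebraMap F L h))) :
    ∃ t : F, Transcendental k t ∧ k⟮t⟯ = ⊤ := by
  obtain ⟨h, hh, hr⟩ := exists_finrank_adjoin_le_of_algHom (K := K) (ι := ι) h1 hx
    (IsScalarTower.toAlgHom k F L)
  have := finiteDimensional_adjoin_simple h1 hh
  obtain ht | ⟨w, s, hs, hw⟩ := exists_hyperelliptic hh (hr.trans h2)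
  · exact ht
  have hkKL : IsScalarTower k K L := .of_algebraMap_eq fun c => by
    rw [IsScalarTower.algebraMap_apply k (MvPolynomial ι k) L,
      IsScalarTower.algebraMap_apply (MvPolynomial ι k) K L,
      ← IsScalarTower.algebraMap_apply k (MvPolynomial ι k) K]
  have hinj : Function.Injective (algebraMap (MvPolynomial ι k) L) := by
    rw [IsScalarTower.algebraMap_eq (MvPolynomial ι k) K L]
    exact (algebraMap K L).injective.comp (IsFractionRing.injective _ K)
  have : FaithfulSMul (MvPolynomial ι k) L := (faithfulSMul_iff_algebraMap_injective _ _).mpr hinj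
  have hind : AlgebraicIndependent k
      fun i : ι => algebraMap (MvPolynomial ι k) L (MvPolynomial.X i) :=
    (MvPolynomial.algebraicIndependent_X ι k).map'
      (f := IsScalarTower.toAlgHom k (MvPolynomial ι k) L) hinj
  have hbasis : IsTranscendenceBasis k
      fun i : ι => algebraMap (MvPolynomial ι k) L (MvPolynomial.X i) := by
    rw [hind.isTranscendenceBasis_iff_isAlgebraic]
    have halg : Algebra.IsAlgebraic (MvPolynomial ι k) L :=
      (IsFractionRing.comap_isAlgebraic_iff (A := MvPolynomial ι k) (K := K)).mpr
        (inferInstance : Algebra.IsAlgebraic K L)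
    refine ⟨fun y => ?_⟩
    obtain ⟨p, hp, hp0⟩ := halg.isAlgebraic y
    let φ : MvPolynomial ι k →+* Algebra.adjoin k
        (Set.range fun i : ι => algebraMap (MvPolynomial ι k) L (MvPolynomial.X i)) :=
      hind.aevalEquiv.toRingEquiv.toRingHom
    have hφ : ∀ q, (φ q : L) = algebraMap (MvPolynomial ι k) L q := fun q => by
      refine (hind.algebraMap_aevalEquiv q).trans ?_
      exact DFunLike.congr_fun (MvPolynomial.aeval_unique
        (IsScalarTower.toAlgHom k (MvPolynomial ι k) L)).symm q
    refine ⟨p.map φ, (Polynomial.map_ne_zero_iff hind.aevalEquiv.injective).mpr hp, ?_⟩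
    rw [Polynomial.aeval_def, Polynomial.eval₂_map, ← hp0, Polynomial.aeval_def]
    congr 1
    exact RingHom.ext hφ
  refine absurd (hσ h hh) (not_transcendental_conj (ι := ι) (k := k)
    (σ := σ.restrictScalars k) hbasis hσ2 (fun p => ?_) (fun y hy => ?_) hh hs hw)
  · change σ _ = _
    rw [IsScalarTower.algebraMap_apply (MvPolynomial ι k) K L, σ.commutes]
  · obtain ⟨z, rfl⟩ := hfix y hy
    obtain ⟨a, b, hb, rfl⟩ := IsFractionRing.div_surjective (A := MvPolynomial ι k) z
    refine ⟨a, b, nonZeroDivisors.ne_zero hb, ?_⟩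
    rw [IsScalarTower.algebraMap_apply (MvPolynomial ι k) K L b, ← map_mul,
      div_mul_cancel₀ _ (IsFractionRing.to_map_ne_zero_of_mem_nonZeroDivisors hb),
      ← IsScalarTower.algebraMap_apply]

theorem adjoin_simple_eq_top_of_finrank_le {k S : Type} [Field k] [Field S] [Algebra k S]
    [Algebra.EssFiniteType k S] (h1 : Algebra.trdeg k S ≤ 1) {h : S} (hh : Transcendental k h)
    (hr : Module.finrank k⟮h⟯ S ≤ 1) : k⟮h⟯ = ⊤ := by
  have := finiteDimensional_adjoin_simple h1 hh
  have hpos : 0 < Module.finrank k⟮h⟯ S := Module.finrank_pos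
  exact IntermediateField.finrank_eq_one_iff_eq_top.mp (by omega)

/-- Lüroth's theorem. -/
theorem exists_adjoin_simple_eq_top_of_intermediateField {k K ι : Type} [Field k] [IsAlgClosed k]
    [CharZero k] [Field K] [Algebra (MvPolynomial ι k) K] [IsFractionRing (MvPolynomial ι k) K]
    [Algebra k K] [IsScalarTower k (MvPolynomial ι k) K] [Finite ι] (S : IntermediateField k K)
    [Algebra.EssFiniteType k S] (h1 : Algebra.trdeg k S ≤ 1) {x : S} (hx : Transcendental k x) :
    ∃ t : S, Transcendental k t ∧ k⟮t⟯ = ⊤ := by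
  obtain ⟨s, hs, hr⟩ := exists_finrank_adjoin_le_of_algHom (K := K) (L := K) (ι := ι) h1 hx S.val
  rw [Module.finrank_self] at hr
  exact ⟨s, hs, adjoin_simple_eq_top_of_finrank_le h1 hs hr⟩

theorem card_eq_sixty_of_isAlgebraic_conj {k K L F G : Type} [Field k] [IsAlgClosed k] [CharZero k]
    [Field K] [Field L] [Field F] [Algebra k K] [Algebra k L] [Algebra k F] [Algebra K L]
    [IsScalarTower k K L] [Algebra F L] [IsScalarTower k F L] [Algebra.EssFiniteType k F]
    (hK : ∀ (S : IntermediateField k K) [Algebra.EssFiniteType k S] (x : S),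
      Algebra.trdeg k S ≤ 1 → Transcendental k x → ∃ t : S, Transcendental k t ∧ k⟮t⟯ = ⊤)
    [Group G] [Finite G] [IsSimpleGroup G]
    (hna : ∃ a b : G, a * b ≠ b * a) (h1 : Algebra.trdeg k F ≤ 1)
    {σ : L ≃ₐ[K] L} (hσ2 : ∀ y, σ (σ y) = y)
    (hfix : ∀ y, σ y = y → y ∈ Set.range (algebraMap K L))
    {ρK : G →* (K ≃ₐ[k] K)} {ρL : G →* (L ≃ₐ[k] L)} {ρF : G →* (F ≃ₐ[k] F)}
    (hKL : ∀ g x, ρL g (algebraMap K L x) = algebraMap K L (ρK g x))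
    (hFL : ∀ g x, ρL g (algebraMap F L x) = algebraMap F L (ρF g x))
    (hρ : Function.Injective ρF) (hc : ∀ g y, ρL g (σ y) = σ (ρL g y))
    {h : F} (hh : Transcendental k h) (hσ : IsAlgebraic F (σ (algebraMap F L h))) :
    Nat.card G = 60 := by
  classical
  have halg : ∀ f : F, IsAlgebraic F (σ (algebraMap F L f)) :=
    isAlgebraic_apply_of_isAlgebraic_apply h1
      ((σ.restrictScalars k).toAlgHom.comp (IsScalarTower.toAlgHom k F L)) hh hσ
  have htr : ∀ f : F, ∃ x : K,
      algebraMap K L x = algebraMap F L f + σ (algebraMap F L f) := fun f =>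
    hfix _ (by rw [map_add, hσ2, add_comm])
  have hN : ∀ f : F, ∃ x : K,
      algebraMap K L x = algebraMap F L f * σ (algebraMap F L f) := fun f =>
    hfix _ (by rw [map_mul, hσ2, mul_comm])
  choose tr htr using htr
  choose N hN using hN
  have htrg : ∀ g f, ρK g (tr f) = tr (ρF g f) := fun g f => (algebraMap K L).injective (by
    rw [← hKL, htr, htr, map_add, hc, hFL])
  have hNg : ∀ g f, ρK g (N f) = N (ρF g f) := fun g f => (algebraMap K L).injective (by
    rw [← hKL, hN, hN, map_mul, hc, hFL])
  obtain ⟨t, ht, hGt⟩ := exists_finset_generators ρF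
  let u : Finset K := t.image tr ∪ t.image N
  let S : IntermediateField k K := IntermediateField.adjoin k (u : Set K)
  have hGu : ∀ g, ∀ z ∈ u, ρK g z ∈ u := fun g z hz => by
    simp only [u, Finset.mem_union, Finset.mem_image] at hz ⊢
    rcases hz with ⟨f, hf, rfl⟩ | ⟨f, hf, rfl⟩
    · exact Or.inl ⟨_, hGt g f hf, (htrg g f).symm⟩
    · exact Or.inr ⟨_, hGt g f hf, (hNg g f).symm⟩
  have hS : ∀ g, ∀ z ∈ S, ρK g z ∈ S := fun g => by
    change S ≤ S.comap (ρK g).toAlgHom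
    exact adjoin_le_iff.mpr fun z hz => subset_adjoin _ _ (hGu g z hz)
  have hSfin : Algebra.EssFiniteType k S := essFiniteType_iff.mpr ⟨u, rfl⟩
  let E := algebraicClosure F L
  have hE1 : Algebra.trdeg k E ≤ 1 := trdeg_le_one_of_isAlgebraic (E := F) h1
  have hSE : ∀ z ∈ S, algebraMap K L z ∈ E := by
    change S ≤ (E.restrictScalars k).comap (IsScalarTower.toAlgHom k K L)
    refine adjoin_le_iff.mpr fun z hz => ?_
    change algebraMap K L z ∈ E
    simp only [u, Finset.coe_union, Finset.coe_image] at hz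
    rcases hz with ⟨f, hf, rfl⟩ | ⟨f, hf, rfl⟩
    · rw [htr]
      exact add_mem (_root_.algebraMap_mem _ _) (mem_algebraicClosure_iff.mpr (halg f))
    · rw [hN]
      exact mul_mem (_root_.algebraMap_mem _ _) (mem_algebraicClosure_iff.mpr (halg f))
  have hS1 : Algebra.trdeg k S ≤ 1 := by
    let j : S →ₐ[k] E :=
      { toFun := fun z => ⟨algebraMap K L z, hSE z z.2⟩
        map_one' := Subtype.ext (map_one (algebraMap K L))
        map_zero' := Subtype.ext (map_zero (algebraMap K L))
        map_add' := fun x y => Subtype.ext (map_add (algebraMap K L) (x : K) y)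
        map_mul' := fun x y => Subtype.ext (map_mul (algebraMap K L) (x : K) y)
        commutes' := fun c => Subtype.ext (by
          change algebraMap K L (algebraMap k K c) = algebraMap E L (algebraMap k E c)
          rw [← IsScalarTower.algebraMap_apply k K L, IsScalarTower.algebraMap_apply k F L,
            IsScalarTower.algebraMap_apply k F E]
          rfl) }
    exact (trdeg_le_of_injective j j.toRingHom.injective).trans hE1
  let ρS := restrictAction ρK S hS
  have hρS : Function.Injective ρS := by
    rw [← MonoidHom.ker_eq_bot_iff]
    refine (IsSimpleGroup.eq_bot_or_eq_top_of_normal ρS.ker inferInstance).resolve_right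
      fun htop => ?_
    obtain ⟨a, b, hab⟩ := hna
    refine hab (mul_comm_of_sq_eq_one (fun g => eq_one_of_forall_mem_generators hρ ht
      fun f hf => ?_) a b)
    have hg : ρS g = 1 := MonoidHom.mem_ker.mp (htop ▸ Subgroup.mem_top g)
    have hgz : ∀ z ∈ u, ρK g z = z := fun z hz =>
      congrArg Subtype.val (DFunLike.congr_fun hg (⟨z, subset_adjoin _ _ hz⟩ : S))
    refine mul_self_apply_of_forall_mem_pair (σ := (σ : L →+* L)) hFL hσ2 hc ?_ ?_
    · have := hgz (tr f) (Finset.mem_union_left _ (Finset.mem_image_of_mem _ hf))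
      rw [htrg] at this
      exact (htr _).symm.trans ((congrArg _ this).trans (htr f))
    · have := hgz (N f) (Finset.mem_union_right _ (Finset.mem_image_of_mem _ hf))
      rw [hNg] at this
      exact (hN _).symm.trans ((congrArg _ this).trans (hN f))
  have : Nontrivial G := IsSimpleGroup.toNontrivial
  obtain ⟨x, hx⟩ := exists_transcendental_of_faithful hρS
  obtain ⟨s, hs, htop⟩ := hK S x hS1 hx
  exact card_eq_sixty_of_adjoin_eq_top hna hs htop ρS hρS

/-- A nonabelian simple group with a faithful action on a curve compatible with an action on a
cover of degree at most two of an affine space has order `60`. -/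
theorem card_eq_sixty_of_finrank_le_two [Nonempty ι] [Group G] [Finite G] [IsSimpleGroup G]
    (hna : ∃ a b : G, a * b ≠ b * a) (h2 : Module.finrank K L ≤ 2) (h1 : Algebra.trdeg k F ≤ 1)
    {ρK : G →* (K ≃ₐ[k] K)} {ρL : G →* (L ≃ₐ[k] L)} {ρF : G →* (F ≃ₐ[k] F)}
    (hKL : ∀ g x, ρL g (algebraMap K L x) = algebraMap K L (ρK g x))
    (hFL : ∀ g x, ρL g (algebraMap F L x) = algebraMap F L (ρF g x))
    (hρ : Function.Injective ρF) : Nat.card G = 60 := by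
  have : CharZero K := charZero_of_injective_algebraMap (algebraMap k K).injective
  have : Nontrivial G := IsSimpleGroup.toNontrivial
  obtain ⟨σ, hσ2, hfix, hτ⟩ := exists_conjugation K L h2
  obtain ⟨x, hx⟩ := exists_transcendental_of_faithful hρ
  by_cases hdep : ∀ h : F, Transcendental k h → Transcendental F (σ (algebraMap F L h))
  · obtain ⟨t, ht, htop⟩ := exists_adjoin_simple_eq_top_of_forall_transcendental (ι := ι) h2 h1
      hσ2 hfix hx hdep
    exact card_eq_sixty_of_adjoin_eq_top hna ht htop ρF hρ
  · push Not at hdep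
    obtain ⟨h, hh, hσ⟩ := hdep
    have hkKL : IsScalarTower k K L := .of_algebraMap_eq fun c => by
      rw [IsScalarTower.algebraMap_apply k (MvPolynomial ι k) L,
        IsScalarTower.algebraMap_apply (MvPolynomial ι k) K L,
        ← IsScalarTower.algebraMap_apply k (MvPolynomial ι k) K]
    exact card_eq_sixty_of_isAlgebraic_conj (fun S _ x hS1 hx =>
      exists_adjoin_simple_eq_top_of_intermediateField (ι := ι) S hS1 hx) hna h1 hσ2 hfix hKL hFL hρ
      (fun g => conj_comm hτ (ρL g) (ρK g) (hKL g)) hh (not_not.mp hσ)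

end QuadraticCovers

section AffineVariety

theorem card_eq_sixty_of_algHom {k K L F G ι : Type} [Field k] [IsAlgClosed k] [CharZero k]
    [Field K] [Field L] [Field F] [Algebra k K] [Algebra k L] [Algebra k F]
    [Algebra (MvPolynomial ι k) K] [IsFractionRing (MvPolynomial ι k) K]
    [IsScalarTower k (MvPolynomial ι k) K] [Finite ι] [Nonempty ι] [Group G] [Finite G]
    [IsSimpleGroup G] (hna : ∃ a b : G, a * b ≠ b * a) (i : K →ₐ[k] L)
    [FiniteDimensional i.fieldRange L] (h2 : Module.finrank i.fieldRange L ≤ 2)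
    [Algebra.EssFiniteType k F] (h1 : Algebra.trdeg k F ≤ 1) (j : F →ₐ[k] L)
    {ρK : G →* (K ≃ₐ[k] K)} {ρL : G →* (L ≃ₐ[k] L)} {ρF : G →* (F ≃ₐ[k] F)}
    (hKL : ∀ g x, ρL g (i x) = i (ρK g x)) (hFL : ∀ g x, ρL g (j x) = j (ρF g x))
    (hρ : Function.Injective ρF) : Nat.card G = 60 := by
  let : Algebra K L := i.toRingHom.toAlgebra
  let : Algebra F L := j.toRingHom.toAlgebra
  let : Algebra (MvPolynomial ι k) L :=
    (i.toRingHom.comp (algebraMap (MvPolynomial ι k) K)).toAlgebra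
  have : IsScalarTower (MvPolynomial ι k) K L := .of_algebraMap_eq fun _ => rfl
  have : IsScalarTower k (MvPolynomial ι k) L := .of_algebraMap_eq fun c => by
    change _ = i (algebraMap (MvPolynomial ι k) K (algebraMap k (MvPolynomial ι k) c))
    rw [← IsScalarTower.algebraMap_apply, i.commutes]
  have : IsScalarTower k F L := .of_algebraMap_eq fun c => (j.commutes c).symm
  let e : i.fieldRange ≃+* K := (RingEquiv.ofBijective i.rangeRestrict
    ⟨fun x y h => i.injective (congrArg Subtype.val h), i.rangeRestrict_surjective⟩).symm
  have he : (algebraMap K L).comp e.toRingHom =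
      (RingEquiv.refl L).toRingHom.comp (algebraMap i.fieldRange L) := by
    ext x
    exact congrArg Subtype.val (e.symm_apply_apply x)
  have : FiniteDimensional K L := Module.Finite.of_equiv_equiv e (RingEquiv.refl L) he
  rw [Algebra.finrank_eq_of_equiv_equiv e (RingEquiv.refl L) he] at h2
  exact card_eq_sixty_of_finrank_le_two (ι := ι) hna h2 h1 hKL hFL hρ

theorem essFiniteType_fractionRing_mvPolynomial (k ι : Type) [Field k] [Finite ι] :
    Algebra.EssFiniteType k (FractionRing (MvPolynomial ι k)) :=
  have := Algebra.EssFiniteType.of_isLocalization (FractionRing (MvPolynomial ι k))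
    (nonZeroDivisors (MvPolynomial ι k))
  Algebra.EssFiniteType.comp k (MvPolynomial ι k) _

/-- The permutation action on the function field of the regular representation. -/
noncomputable def regularAction (k G : Type) [Field k] [Group G] :
    G →* (FractionRing (MvPolynomial G k) ≃ₐ[k] FractionRing (MvPolynomial G k)) :=
  (IsFractionRing.fieldEquivOfAlgEquivHom (A := k) (B := MvPolynomial G k) k
    (FractionRing (MvPolynomial G k))).comp
  { toFun := fun g => MvPolynomial.renameEquiv k (Equiv.mulLeft g)
    map_one' := by
      rw [Equiv.mulLeft_one]
      exact MvPolynomial.renameEquiv_refl k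
    map_mul' := fun g h => by
      have hgh : Equiv.mulLeft (g * h) = (Equiv.mulLeft h).trans (Equiv.mulLeft g) :=
        Equiv.ext fun x => mul_assoc g h x
      rw [hgh]
      exact (MvPolynomial.renameEquiv_trans k _ _).symm }

theorem regularAction_injective (k G : Type) [Field k] [Group G] :
    Function.Injective (regularAction k G) := by
  refine (IsFractionRing.fieldEquivOfAlgEquivHom_injective k (MvPolynomial G k) k
    (FractionRing (MvPolynomial G k))).comp fun g h hgh => ?_
  have := DFunLike.congr_fun hgh (MvPolynomial.X (1 : G))
  simpa using this

end AffineVariety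

section FunctionFields

variable {k K : Type} [Field k] [Field K] [Algebra k K]

theorem isFunctionField_iff_essFiniteType :
    IsFunctionField k K ↔ Algebra.EssFiniteType k K :=
  IntermediateField.fg_top_iff

theorem DimLE.trdeg_le {d : ℕ} (h : DimLE k K d) : Algebra.trdeg k K ≤ d := by
  obtain ⟨s, hs, halg⟩ := h
  have : Algebra.IsAlgebraic (Algebra.adjoin k (s : Set K)) K := isAlgebraic_adjoin_iff_top.mp halg
  refine (Algebra.IsAlgebraic.trdeg_le_cardinalMk k (s : Set K)).trans ?_
  simpa using hs

end FunctionFields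

/-- Let `G` be any non-abelian finite simple group not isomorphic to `A₅`.
Then `ed_ℂ(G; ≤ 2) > 1`. -/
theorem edC_le_two_gt_one_of_simple (G : Type) [Group G] [Finite G] [IsSimpleGroup G]
    (hnonab : ∃ a b : G, a * b ≠ b * a)
    (hA5 : IsEmpty (G ≃* alternatingGroup (Fin 5))) :
    ¬ EDLE ℂ G 2 1 := by
  intro h
  obtain ⟨T, Y, ⟨i, hfd, h2, hi⟩, ⟨j, hj⟩, hd⟩ := h
    { K := FractionRing (MvPolynomial G ℂ)
      fg := isFunctionField_iff_essFiniteType.mpr (essFiniteType_fractionRing_mvPolynomial ℂ G)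
      action := regularAction ℂ G
      faithful := regularAction_injective ℂ G }
  have := isFunctionField_iff_essFiniteType.mp Y.fg
  have hc : Nat.card G = 60 := card_eq_sixty_of_algHom (ι := G)
    (K := FractionRing (MvPolynomial G ℂ)) hnonab i h2 (by simpa using hd.trdeg_le) j hi hj
    Y.faithful
  exact hA5.elim (nonempty_mulEquiv_alternatingGroup_of_card_eq_sixty hc).some
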